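/- Fix integers m ≥ 3, R ≥ m−2, set a = 3^R, and fix n₀ ≤ N₀ in ℕ. Let H₁ and H₂ be graphs on vertex sets [n₁] and [n₂] respectively, each with minimum degree at least m, whose induced subgraphs on [N₀] coincide: H₁|_{[N₀]} = H₂|_{[N₀]}. Suppose both H₁ and H₂ satisfy: (Q1) every cycle with at most a vertices either has all vertices inside [N₀] and every path of length at most a connecting [n₀] with this cycle has all vertices inside [N₀], or is at distance at least a from [n₀]; every path with at most a vertices joining two vertices of [n₀] has all vertices inside [N₀]; and any two cycles with at most a vertices each, all of whose vertices lie outside [n₀], are at distance at least a from each other; (Q2) for every b with 3 ≤ b ≤ a there exist at least m distinct cycles of length b with all vertices outside [N₀]; (Q3) every vertex of [N₀] has degree at least N₀ + m. Then H₁ and H₂ satisfy exactly the same first-order sentences that use at most m−2 distinct variables and have quantifier depth at most R (equivalently, Duplicator wins the (m−2)-pebble Ehrenfeucht–Fraïssé game of R rounds on H₁ and H₂). -/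

import Mathlib

/-- The degree of a vertex in a graph on `ℕ` (number of neighbors). -/
noncomputable def ndeg (G : SimpleGraph ℕ) (u : ℕ) : ℕ := {v | G.Adj u v}.ncard

/-- First-order formulas about graphs: variables are indexed by `ℕ`, atomic formulas are
equality and adjacency of variables, with Boolean connectives and quantifiers over vertices. -/
inductive FOFormula : Type
  | eq : ℕ → ℕ → FOFormula
  | adj : ℕ → ℕ → FOFormula
  | not : FOFormula → FOFormula
  | and : FOFormula → FOFormula → FOFormula
  | or : FOFormula → FOFormula → FOFormula
  | ex : ℕ → FOFormula → FOFormula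
  | all : ℕ → FOFormula → FOFormula

namespace FOFormula

/-- The set of (distinct) variables occurring in a formula. -/
def vars : FOFormula → Finset ℕ
  | eq i j => {i, j}
  | adj i j => {i, j}
  | not φ => φ.vars
  | and φ ψ => φ.vars ∪ ψ.vars
  | or φ ψ => φ.vars ∪ ψ.vars
  | ex i φ => insert i φ.vars
  | all i φ => insert i φ.vars

/-- The set of free variables of a formula; a sentence has no free variables. -/
def freeVars : FOFormula → Finset ℕ
  | eq i j => {i, j}
  | adj i j => {i, j}
  | not φ => φ.freeVars
  | and φ ψ => φ.freeVars ∪ ψ.freeVars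
  | or φ ψ => φ.freeVars ∪ ψ.freeVars
  | ex i φ => φ.freeVars.erase i
  | all i φ => φ.freeVars.erase i

/-- Quantifier depth: the maximum number of nested quantifiers. -/
def qdepth : FOFormula → ℕ
  | eq _ _ => 0
  | adj _ _ => 0
  | not φ => φ.qdepth
  | and φ ψ => max φ.qdepth ψ.qdepth
  | or φ ψ => max φ.qdepth ψ.qdepth
  | ex _ φ => φ.qdepth + 1
  | all _ φ => φ.qdepth + 1

/-- Evaluation of a formula in the graph `G` with vertex set `V ⊆ ℕ` under a
valuation `v` of the variables; quantifiers range over `V`. -/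
def Eval (G : SimpleGraph ℕ) (V : Finset ℕ) : FOFormula → (ℕ → ℕ) → Prop
  | eq i j, v => v i = v j
  | adj i j, v => G.Adj (v i) (v j)
  | not φ, v => ¬ Eval G V φ v
  | and φ ψ, v => Eval G V φ v ∧ Eval G V ψ v
  | or φ ψ, v => Eval G V φ v ∨ Eval G V ψ v
  | ex i φ, v => ∃ x ∈ V, Eval G V φ (Function.update v i x)
  | all i φ, v => ∀ x ∈ V, Eval G V φ (Function.update v i x)

/-- The graph `G` with vertex set `V` satisfies `φ` (under every valuation into `V`;
for a sentence, i.e. a formula without free variables, this does not depend on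
the valuation as long as `V ≠ ∅`). -/
def Sat (G : SimpleGraph ℕ) (V : Finset ℕ) (φ : FOFormula) : Prop :=
  ∀ v : ℕ → ℕ, (∀ i, v i ∈ V) → Eval G V φ v

end FOFormula

/-- Property `Q1` for a graph `G` and parameters `a`, `n₀`, `N₀`:
(i) every cycle with at most `a` vertices either lies inside `[N₀]` together with all paths of
length at most `a` connecting it to `[n₀]`, or is at distance at least `a` from `[n₀]`;
(ii) every path with at most `a` vertices joining two vertices of `[n₀]` lies inside `[N₀]`;
(iii) any two distinct cycles with at most `a` vertices each, all of whose vertices lie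
outside `[n₀]`, are at distance at least `a` from each other. -/
def PropQ1 (G : SimpleGraph ℕ) (a n₀ N₀ : ℕ) : Prop :=
  (∀ (x : ℕ) (w : G.Walk x x), w.IsCycle → w.length ≤ a →
      ((∀ v ∈ w.support, v ∈ Finset.Icc 1 N₀) ∧
        (∀ (u y : ℕ) (p : G.Walk u y), u ∈ Finset.Icc 1 n₀ → y ∈ w.support →
          p.IsPath → p.length ≤ a → ∀ z ∈ p.support, z ∈ Finset.Icc 1 N₀)) ∨
      (∀ u ∈ Finset.Icc 1 n₀, ∀ v ∈ w.support, ∀ p : G.Walk u v, a ≤ p.length)) ∧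
  (∀ (u y : ℕ) (p : G.Walk u y), u ∈ Finset.Icc 1 n₀ → y ∈ Finset.Icc 1 n₀ →
      p.IsPath → p.support.length ≤ a → ∀ z ∈ p.support, z ∈ Finset.Icc 1 N₀) ∧
  (∀ (x₁ x₂ : ℕ) (w₁ : G.Walk x₁ x₁) (w₂ : G.Walk x₂ x₂),
      w₁.IsCycle → w₂.IsCycle → w₁.length ≤ a → w₂.length ≤ a →
      (∀ v ∈ w₁.support, v ∉ Finset.Icc 1 n₀) →
      (∀ v ∈ w₂.support, v ∉ Finset.Icc 1 n₀) →
      w₁.edges.toFinset ≠ w₂.edges.toFinset →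
      ∀ u ∈ w₁.support, ∀ v ∈ w₂.support, ∀ p : G.Walk u v, a ≤ p.length)

/-- Property `Q2` for a graph `G` and parameters `a`, `m`, `N₀`: for every `b` with
`3 ≤ b ≤ a` there exist at least `m` distinct cycles of length `b` (distinct cycles have
distinct edge sets) with all vertices outside `[N₀]`. -/
def PropQ2 (G : SimpleGraph ℕ) (a m N₀ : ℕ) : Prop :=
  ∀ b : ℕ, 3 ≤ b → b ≤ a →
    ∃ f : Fin m → Σ x : ℕ, G.Walk x x,
      (∀ i, (f i).2.IsCycle ∧ (f i).2.length = b ∧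
        ∀ v ∈ (f i).2.support, v ∉ Finset.Icc 1 N₀) ∧
      ∀ i j : Fin m, i ≠ j → (f i).2.edges.toFinset ≠ (f j).2.edges.toFinset

namespace HullGame
open SimpleGraph

section Walks

variable {V : Type*} {G G' : SimpleGraph V} {T T' : V → V → Prop}

/-- `NB G T u v n`: some non-backtracking walk in `G` with `n` edges starts with the dart
`(u, v)` and its last dart satisfies `T`. -/
inductive NB (G : SimpleGraph V) (T : V → V → Prop) : V → V → ℕ → Prop
  | base {u v : V} : G.Adj u v → T u v → NB G T u v 1
  | step {u v w : V} {n : ℕ} : G.Adj u v → w ≠ u → NB G T v w n → NB G T u v (n + 1)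

/-- Darts that end in `S`. -/
def into (S : Set V) : V → V → Prop := fun _ v => v ∈ S

/-- The single dart `(p, q)`. -/
def dart (p q : V) : V → V → Prop := fun u v => u = p ∧ v = q

theorem NB.adj {u v : V} {n : ℕ} (h : NB G T u v n) : G.Adj u v := by
  cases h <;> assumption

theorem NB.pos {u v : V} {n : ℕ} (h : NB G T u v n) : 1 ≤ n := by
  cases h <;> omega

theorem NB.map {W : Type*} {G' : SimpleGraph W} {T' : W → W → Prop} (e : V → W)
    (he : Function.Injective e)
    (hG : ∀ u v, G.Adj u v → G'.Adj (e u) (e v)) (hT : ∀ u v, T u v → T' (e u) (e v))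
    {u v : V} {n : ℕ} (h : NB G T u v n) : NB G' T' (e u) (e v) n := by
  induction h with
  | base h1 h2 => exact .base (hG _ _ h1) (hT _ _ h2)
  | step h1 h2 _ ih => exact .step (hG _ _ h1) (fun h => h2 (he h)) ih

theorem NB.mono (hG : G ≤ G') (hT : ∀ u v, T u v → T' u v) {u v : V} {n : ℕ}
    (h : NB G T u v n) : NB G' T' u v n :=
  h.map id Function.injective_id (fun _ _ h => hG h) hT

theorem NB.snoc {p q r u v : V} {n : ℕ} (h : NB G (dart p q) u v n) (hqr : G.Adj q r)
    (hrp : r ≠ p) (hT : T q r) : NB G T u v (n + 1) := by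
  induction h with
  | base h1 h2 =>
    obtain ⟨rfl, rfl⟩ := h2
    exact .step h1 hrp (.base hqr hT)
  | step h1 h2 _ ih => exact .step h1 h2 ih

theorem NB.last {u v : V} {n : ℕ} (h : NB G T u v n) :
    ∃ p q, T p q ∧ NB G (dart p q) u v n := by
  induction h with
  | base h1 h2 => exact ⟨_, _, h2, .base h1 ⟨rfl, rfl⟩⟩
  | step h1 h2 _ ih =>
    obtain ⟨p, q, hT, h⟩ := ih
    exact ⟨p, q, hT, .step h1 h2 h⟩

theorem NB.rev {p q u v : V} {n : ℕ} (h : NB G (dart p q) u v n) :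
    NB G (dart v u) q p n := by
  induction h with
  | base h1 h2 =>
    obtain ⟨rfl, rfl⟩ := h2
    exact .base h1.symm ⟨rfl, rfl⟩
  | step h1 h2 _ ih => exact ih.snoc h1.symm (Ne.symm h2) ⟨rfl, rfl⟩

theorem NB.overlap {p q u v : V} {n k : ℕ} (h : NB G (dart p q) u v n) (h' : NB G T p q k) :
    NB G T u v (n + k - 1) := by
  induction h with
  | base h1 h2 =>
    obtain ⟨rfl, rfl⟩ := h2
    simpa using h'
  | step h1 h2 h3 ih =>
    have := h3.pos
    rw [show ∀ n, 1 ≤ n → n + 1 + k - 1 = n + k - 1 + 1 by intros; omega]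
    · exact .step h1 h2 ih
    · exact this

theorem NB.join {x u v : V} {a b : ℕ} (hb : NB G (into {x}) v u b) (ha : NB G T u v a) :
    ∃ r, NB G T x r (a + b - 1) := by
  obtain ⟨p, q, hq, h⟩ := hb.last
  obtain rfl : q = x := hq
  exact ⟨p, by simpa [add_comm] using h.rev.overlap ha⟩

theorem NB.toWalk {u v : V} {n : ℕ} (h : NB G T u v n) :
    ∃ p q, T p q ∧ ∃ w : G.Walk v q, w.length + 1 = n := by
  induction h with
  | base h1 h2 => exact ⟨_, _, h2, .nil, rfl⟩
  | step h1 h2 h3 ih =>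
    obtain ⟨p, q, hT, w, rfl⟩ := ih
    exact ⟨p, q, hT, .cons h3.adj w, rfl⟩

theorem into_mono {S S' : Set V} (h : S ⊆ S') : ∀ u v, into S u v → into S' u v :=
  fun _ _ hv => h hv

/-- If `A ≤ G` reaches its target from `x`, then every walk of `G` into `x` either extends to one
reaching the target, or its first edge is traversed backwards by the walk in `A`. -/
theorem NB.splice {A : SimpleGraph V} (hA : A ≤ G) {x x₁ u v : V} {a h : ℕ}
    (hx : NB A T x x₁ h) (hu : NB G (into {x}) u v a) :
    (∃ c ≤ a + h, NB G (fun _ q => ∃ p, T p q) u v c) ∨ ∃ i, i + a ≤ h + 1 ∧ NB A T v u i := by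
  have hT : ∀ p q, T p q → ∃ p, T p q := fun p q h => ⟨p, h⟩
  induction hu with
  | @base u v h1 h2 =>
    obtain rfl : v = x := h2
    rcases eq_or_ne x₁ u with rfl | hne
    · exact .inr ⟨h, le_rfl, hx⟩
    · exact .inl ⟨h + 1, by omega, .step h1 hne (hx.mono hA hT)⟩
  | @step u v w n h1 h2 h3 ih =>
    rcases ih with ⟨c, hc, h4⟩ | ⟨i, hi, h4⟩
    · exact .inl ⟨c + 1, by omega, .step h1 h2 h4⟩
    · cases h4 with
      | base h5 h6 => exact .inl ⟨1, by omega, .base h1 ⟨_, h6⟩⟩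
      | @step _ _ w₂ j h5 h6 h7 =>
        rcases eq_or_ne w₂ u with rfl | hne
        · exact .inr ⟨j, by omega, h7⟩
        · exact .inl ⟨j + 1, by omega, .step h1 hne (h7.mono hA hT)⟩

theorem NB.splice_into {A : SimpleGraph V} (hA : A ≤ G) {S : Set V} {x x₁ u v : V} {a h : ℕ}
    (hx : NB A (into S) x x₁ h) (hu : NB G (into {x}) u v a) :
    (∃ c ≤ a + h, NB G (into S) u v c) ∨ ∃ i, i + a ≤ h + 1 ∧ NB A (into S) v u i :=
  (hx.splice hA hu).imp_left fun ⟨c, hc, h⟩ =>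
    ⟨c, hc, h.mono le_rfl fun _ _ h => h.choose_spec⟩

/-- Two walks leaving `z` along different edges and meeting in `y` yield a closed walk at `z`. -/
theorem NB.zipper {y z u u' : V} {n n' : ℕ} (h : NB G (into {y}) z u n)
    (h' : NB G (into {y}) z u' n') (hne : u ≠ u') :
    ∃ w, (w = u ∨ w = u') ∧ ∃ k ≤ n + n', NB G (into {z}) z w k := by
  obtain ⟨p, q, hq, hr⟩ := h'.last
  obtain rfl : q = y := hq
  rcases hr.rev.splice le_rfl h with ⟨c, hc, h1⟩ | ⟨i, hi, h1⟩
  · exact ⟨u, .inl rfl, c, hc, h1.mono le_rfl fun _ _ ⟨_, h⟩ => h.2⟩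
  · cases h1 with
    | base _ h2 => exact absurd h2.1 hne
    | step _ _ h2 => exact ⟨u', .inr rfl, _, by omega, h2.rev.mono le_rfl fun _ _ h => h.2⟩

/-- The graph obtained from `G` by deleting all edges that meet `S`. -/
def off (G : SimpleGraph V) (S : Set V) : SimpleGraph V where
  Adj u v := G.Adj u v ∧ u ∉ S ∧ v ∉ S
  symm := ⟨fun _ _ h => ⟨h.1.symm, h.2.2, h.2.1⟩⟩
  loopless := ⟨fun _ h => G.loopless.irrefl _ h.1⟩

theorem off_le (S : Set V) : off G S ≤ G := fun _ _ h => h.1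

/-- A walk that never enters `S` lives in `off G S`. -/
theorem NB.avoid {S : Set V} (hT : ∀ u v, T u v → v ∉ S → T' u v) {u v : V} {n : ℕ}
    (h : NB G T u v n) (hu : u ∉ S) :
    (∃ c ≤ n, NB G (into S) u v c) ∨ NB (off G S) T' u v n := by
  induction h with
  | @base u v h1 h2 =>
    by_cases hv : v ∈ S
    · exact .inl ⟨1, le_rfl, .base h1 hv⟩
    · exact .inr (.base ⟨h1, hu, hv⟩ (hT _ _ h2 hv))
  | @step u v w n h1 h2 h3 ih =>
    by_cases hv : v ∈ S
    · exact .inl ⟨1, by omega, .base h1 hv⟩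
    · rcases ih hv with ⟨c, hc, h4⟩ | h4
      · exact .inl ⟨c + 1, by omega, .step h1 h2 h4⟩
      · exact .inr (.step ⟨h1, hu, hv⟩ h2 h4)

theorem nb_of_isTrail {s t : V} (p : G.Walk s t) (hp : p.IsTrail) (hn : ¬p.Nil) :
    NB G (dart p.penultimate t) s p.snd p.length := by
  induction p with
  | nil => simp at hn
  | @cons u v w h p ih =>
    cases p with
    | nil => exact .base h ⟨rfl, rfl⟩
    | @cons _ v' _ h' p' =>
      refine .step h ?_ (ih hp.of_cons (by simp))
      rintro rfl
      have := (SimpleGraph.Walk.isTrail_cons _ _).1 hp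
      simp [Sym2.eq_swap] at this

theorem nb_of_mem_darts {s t : V} (p : G.Walk s t) (hp : p.IsTrail) (d : G.Dart)
    (hd : d ∈ p.darts) : ∃ i j, i + j = p.length + 1 ∧
      NB G (into {t}) d.fst d.snd i ∧ NB G (dart p.snd s) d.snd d.fst j := by
  induction p with
  | nil => simp at hd
  | @cons u v w h p ih =>
    have htr := (SimpleGraph.Walk.isTrail_cons _ _).1 hp
    rw [SimpleGraph.Walk.darts_cons, List.mem_cons] at hd
    rcases hd with rfl | hd
    · refine ⟨p.length + 1, 1, by simp, ?_, .base h.symm ⟨by simp, rfl⟩⟩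
      simpa using (nb_of_isTrail _ hp (by simp)).mono (T' := into {w}) le_rfl fun _ _ h => h.2
    · obtain ⟨i, j, hij, hi, hj⟩ := ih htr.1 hd
      refine ⟨i, j + 1, by simp; omega, hi, ?_⟩
      refine hj.snoc h.symm ?_ ⟨by simp, rfl⟩
      rintro rfl
      refine htr.2 ?_
      have hnil : ¬p.Nil := by
        intro hnil
        rw [← SimpleGraph.Walk.length_eq_zero_iff] at hnil
        have := SimpleGraph.Walk.length_darts p
        rw [hnil, List.length_eq_zero_iff] at this
        simp [this] at hd
      rw [Sym2.eq_swap]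
      exact SimpleGraph.Walk.mk_start_snd_mem_edges hnil

theorem nb_of_walk {S : Set V} {u s : V} (w : G.Walk u s) (hs : s ∈ S) :
    u ∈ S ∨ ∃ r, ∃ k ≤ w.length, NB G (into S) u r k := by
  classical
  by_cases hn : w.bypass.Nil
  · exact .inl (hn.eq ▸ hs)
  · refine .inr ⟨_, _, w.length_bypass_le_length,
      (nb_of_isTrail _ w.bypass_isPath.isTrail hn).mono le_rfl ?_⟩
    rintro _ _ ⟨-, rfl⟩
    exact hs

end Walks

section Hull

variable {V : Type*} {G G' : SimpleGraph V} {T : V → V → Prop}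

/-- Edges through which a non-backtracking walk with at most `d` edges leads from `S` to `S`. -/
def hull (G : SimpleGraph V) (S : Set V) (d : ℕ) : SimpleGraph V where
  Adj u v := ∃ a b, NB G (into S) u v a ∧ NB G (into S) v u b ∧ a + b ≤ d + 1
  symm := ⟨fun _ _ ⟨a, b, h, h', hab⟩ => ⟨b, a, h', h, by omega⟩⟩
  loopless := ⟨fun _ ⟨_, _, h, _⟩ => G.loopless.irrefl _ h.adj⟩

theorem hull_le (S : Set V) (d : ℕ) : hull G S d ≤ G := fun _ _ ⟨_, _, h, _⟩ => h.adj

theorem hull_mono (hG : G ≤ G') {S S' : Set V} (hS : S ⊆ S') {d d' : ℕ} (hd : d ≤ d') :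
    hull G S d ≤ hull G' S' d' := fun _ _ ⟨a, b, h, h', hab⟩ =>
  ⟨a, b, h.mono hG (into_mono hS), h'.mono hG (into_mono hS), by omega⟩

/-- `x` is in `S` or some non-backtracking walk of length at most `d` leads from `x` to `S`. -/
def Near (G : SimpleGraph V) (S : Set V) (x : V) (d : ℕ) : Prop :=
  x ∈ S ∨ ∃ r, ∃ k ≤ d, NB G (into S) x r k

theorem NB.in_hull {S : Set V} {d u v a b : _} (ha : NB G (into S) u v a)
    (hb : NB G (into S) v u b) (hab : a + b ≤ d + 1) : NB (hull G S d) (into S) u v a := by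
  induction ha generalizing b with
  | base h1 h2 => exact .base ⟨_, _, .base h1 h2, hb, hab⟩ h2
  | step h1 h2 h3 ih =>
    exact .step ⟨_, _, .step h1 h2 h3, hb, hab⟩ h2
      (ih (.step h3.adj.symm (Ne.symm h2) hb) (by omega))

/-- The bijection `f` is an isomorphism between the graphs `A` and `B`. -/
def Carries {W : Type*} (f : V ≃ W) (A : SimpleGraph V) (B : SimpleGraph W) : Prop :=
  ∀ u v, A.Adj u v ↔ B.Adj (f u) (f v)

theorem Carries.symm {W : Type*} {f : V ≃ W} {A : SimpleGraph V} {B : SimpleGraph W}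
    (h : Carries f A B) : Carries f.symm B A := fun u v => by simp [h (f.symm u) (f.symm v)]

theorem Carries.nb {W : Type*} {f : V ≃ W} {A : SimpleGraph V} {B : SimpleGraph W}
    (h : Carries f A B) {S : Set V} {u v : V} {n : ℕ} (hu : NB A (into S) u v n) :
    NB B (into (f '' S)) (f u) (f v) n :=
  hu.map f f.injective (fun u v => (h u v).1) fun _ _ h => ⟨_, h, rfl⟩

theorem Carries.hull_le {W : Type*} {f : V ≃ W} {A G : SimpleGraph V} {B H : SimpleGraph W}
    (h : Carries f A B) {S : Set V} {d : ℕ} (hA : hull G S d ≤ A) (hB : B ≤ H) {u v : V}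
    (huv : (hull G S d).Adj u v) : (hull H (f '' S) d).Adj (f u) (f v) := by
  obtain ⟨a, b, ha, hb, hab⟩ := huv
  exact ⟨a, b, (h.nb ((ha.in_hull hb hab).mono hA fun _ _ => id)).mono hB fun _ _ => id,
    (h.nb ((hb.in_hull ha (by omega)).mono hA fun _ _ => id)).mono hB fun _ _ => id, hab⟩

/-- An isomorphism of intermediate graphs restricts to one of the hulls. -/
theorem Carries.hull {W : Type*} {f : V ≃ W} {A G : SimpleGraph V} {B H : SimpleGraph W}
    (h : Carries f A B) {S : Set V} {d : ℕ} (hAG : A ≤ G) (hBH : B ≤ H)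
    (hA : hull G S d ≤ A) (hB : HullGame.hull H (f '' S) d ≤ B) :
    Carries f (HullGame.hull G S d) (HullGame.hull H (f '' S) d) := fun u v => by
  refine ⟨h.hull_le hA hBH, fun huv => ?_⟩
  have hS : S = f.symm '' (f '' S) := by simp
  have := h.symm.hull_le hB hAG huv
  rw [← hS] at this
  simpa using this

/-- A trail stays in the hull of its ends. -/
theorem trail_le_hull {S : Set V} {s t : V} (hs : s ∈ S) (ht : t ∈ S) (p : G.Walk s t)
    (hp : p.IsTrail) {d : ℕ} (hd : p.length ≤ d) {u v : V} (he : s(u, v) ∈ p.edges) :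
    (hull G S d).Adj u v := by
  obtain ⟨D, hD, hDe⟩ := List.mem_map.1 he
  obtain ⟨i, j, hij, hi, hj⟩ := nb_of_mem_darts p hp D hD
  have : (hull G S d).Adj D.fst D.snd :=
    ⟨i, j, hi.mono le_rfl (into_mono (by simpa using ht)),
      hj.mono le_rfl fun _ _ h => by rw [h.2]; exact hs, by omega⟩
  rcases Sym2.eq_iff.1 (show s(D.fst, D.snd) = s(u, v) from hDe) with ⟨rfl, rfl⟩ | ⟨rfl, rfl⟩
  · exact this
  · exact this.symm

end Hull

section Repeat

variable {V : Type*} {G : SimpleGraph V} {T : V → V → Prop}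

/-- Extending a path by a non-backtracking walk, either the result is a path, or a first cycle
`c` closes, attached to the start by a path `τ`. -/
theorem NB.path_or_lollipop {t x y : V} {n : ℕ} (h : NB G T x y n) (p : G.Walk t x)
    (hp : p.IsPath) (hy : p.penultimate ≠ y) :
    (∃ (z : V) (q : G.Walk t z), q.IsPath ∧ p.edges ⊆ q.edges ∧ s(x, y) ∈ q.edges ∧
      q.length = p.length + n ∧ T q.penultimate z) ∨
    ∃ (z : V) (τ : G.Walk t z) (c : G.Walk z z), τ.IsPath ∧ c.IsCycle ∧
      (∀ e, e ∈ p.edges ∨ e = s(x, y) → e ∈ τ.edges ∨ e ∈ c.edges) ∧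
      τ.length + c.length ≤ p.length + n ∧
      ((∃ o, s(o, z) ∈ c.edges ∧ T o z) ∨
        ∃ y' k, NB G T z y' k ∧ k + τ.length + c.length = p.length + n) := by
  classical
  have key : ∀ {x y : V} (p : G.Walk t x), p.IsPath → p.penultimate ≠ y → ∀ h : G.Adj x y,
      y ∈ p.support → ∃ (τ : G.Walk t y) (c : G.Walk y y), τ.IsPath ∧ c.IsCycle ∧
      (∀ e, e ∈ p.edges ∨ e = s(x, y) → e ∈ τ.edges ∨ e ∈ c.edges) ∧
      τ.length + c.length = p.length + 1 ∧ s(x, y) ∈ c.edges := by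
    intro x y p hp hy h hmem
    refine ⟨p.takeUntil y hmem, .cons h.symm (p.dropUntil y hmem).reverse, hp.takeUntil _, ?_,
      ?_, ?_, ?_⟩
    · rw [Walk.cons_isCycle_iff]
      refine ⟨(hp.dropUntil _).reverse, fun he => hy ?_⟩
      rw [Walk.edges_reverse, List.mem_reverse, Sym2.eq_swap] at he
      have := p.edges_dropUntil_subset_edges hmem he
      exact (hp.eq_penultimate_of_mem_edges (Sym2.eq_swap ▸ this)).symm
    · rintro e (he | rfl)
      · rw [← p.take_spec hmem, Walk.edges_append, List.mem_append] at he
        simpa using he.imp_right .inr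
      · simp [Sym2.eq_swap]
    · have := congrArg Walk.length (p.take_spec hmem)
      simp only [Walk.length_append, Walk.length_cons, Walk.length_reverse] at this ⊢
      omega
    · simp [Sym2.eq_swap]
  induction h with
  | @base x y h1 h2 =>
    by_cases hmem : y ∈ p.support
    · obtain ⟨τ, c, h3, h4, h5, h6, h7⟩ := key p hp hy h1 hmem
      exact .inr ⟨y, τ, c, h3, h4, h5, h6.le, .inl ⟨x, h7, h2⟩⟩
    · refine .inl ⟨y, p.concat h1, hp.concat hmem h1, ?_, ?_, by simp, by simpa using h2⟩ <;>
        simp [Walk.edges_concat]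
  | @step x y w n h1 h2 h3 ih =>
    by_cases hmem : y ∈ p.support
    · obtain ⟨τ, c, h4, h5, h6, h7, h8⟩ := key p hp hy h1 hmem
      exact .inr ⟨y, τ, c, h4, h5, h6, by omega, .inr ⟨w, n, h3, by omega⟩⟩
    · rcases ih (p.concat h1) (hp.concat hmem h1) (by simpa using Ne.symm h2) with
        ⟨z, q, h4, h5, h6, h7, h8⟩ | ⟨z, τ, c, h4, h5, h6, h7, h8⟩
      · refine .inl ⟨z, q, h4, fun e he => h5 (by simp [Walk.edges_concat, he]),
          h5 (by simp [Walk.edges_concat]), ?_, h8⟩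
        simp at h7; omega
      · refine .inr ⟨z, τ, c, h4, h5, fun e he => h6 e (.inl ?_), ?_, ?_⟩
        · simpa [Walk.edges_concat] using he
        · simp at h7; omega
        · simp only [Walk.length_concat] at h8
          refine h8.imp_right fun ⟨y', k, h9, h10⟩ => ⟨y', k, h9, by omega⟩

theorem NB.lollipop_of_nil {x y : V} {n : ℕ} (h : NB G T x y n) :
    (∃ (z : V) (q : G.Walk x z), q.IsPath ∧ s(x, y) ∈ q.edges ∧
      q.length = n ∧ T q.penultimate z) ∨
    ∃ (z : V) (τ : G.Walk x z) (c : G.Walk z z), τ.IsPath ∧ c.IsCycle ∧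
      (s(x, y) ∈ τ.edges ∨ s(x, y) ∈ c.edges) ∧ τ.length + c.length ≤ n ∧
      ((∃ o, s(o, z) ∈ c.edges ∧ T o z) ∨
        ∃ y' k, NB G T z y' k ∧ k + τ.length + c.length = n) := by
  rcases h.path_or_lollipop .nil .nil (by simpa using h.adj.ne) with
    ⟨z, q, h1, -, h2, h3, h4⟩ | ⟨z, τ, c, h1, h2, h3, h4, h5⟩
  · exact .inl ⟨z, q, h1, h2, by simpa using h3, h4⟩
  · exact .inr ⟨z, τ, c, h1, h2, h3 _ (.inr rfl), by simpa using h4, by simpa using h5⟩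

/-- A closed non-backtracking walk of length `n` contains a cycle at bounded distance. -/
theorem NB.exists_cycle {x w : V} {n : ℕ} (h : NB G (into {x}) x w n) :
    ∃ (z : V) (τ : G.Walk x z) (c : G.Walk z z), c.IsCycle ∧ 2 * τ.length + c.length ≤ n := by
  rcases h.lollipop_of_nil with ⟨z, q, h1, h2, -, h4⟩ | ⟨z, τ, c, -, h2, -, h4, h5⟩
  · obtain rfl : z = x := h4
    rw [(Walk.isPath_iff_nil.1 h1).eq_nil] at h2
    simp at h2
  · rcases h5 with ⟨o, h5, rfl⟩ | ⟨y', k, h5, h6⟩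
    · exact ⟨z, .nil, c, h2, by simp; omega⟩
    · rcases le_total τ.length k with hle | hle
      · exact ⟨z, τ, c, h2, by omega⟩
      · obtain ⟨p, q, hq, w, hw⟩ := h5.toWalk
        obtain rfl : q = x := hq
        exact ⟨z, (Walk.cons h5.adj w).reverse, c, h2, by simp; omega⟩

end Repeat

section Confined

variable {V : Type*} {G M : SimpleGraph V} {T : Set V} {L : ℕ}

/-- Short paths between vertices of `T` and short lollipops hanging from `T` use only edges
of `M`. -/
structure Confined (G : SimpleGraph V) (T : Set V) (M : SimpleGraph V) (L : ℕ) : Prop where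
  le : M ≤ G
  path : ∀ s ∈ T, ∀ t ∈ T, ∀ p : G.Walk s t, p.IsPath → p.length ≤ L →
    ∀ u v, s(u, v) ∈ p.edges → M.Adj u v
  lollipop : ∀ t ∈ T, ∀ (z : V) (τ : G.Walk t z) (c : G.Walk z z), τ.IsPath → c.IsCycle →
    τ.length + c.length ≤ L → ∀ u v, s(u, v) ∈ τ.edges ∨ s(u, v) ∈ c.edges → M.Adj u v

theorem Confined.anti (h : Confined G T M L) {L' : ℕ} (hL : L' ≤ L) : Confined G T M L' :=
  ⟨h.le, fun s hs t ht p hp hl => h.path s hs t ht p hp (by omega),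
    fun t ht z τ c hτ hc hl => h.lollipop t ht z τ c hτ hc (by omega)⟩

theorem Confined.adj (hM : Confined G T M L) {u v : V} {a b : ℕ} (ha : NB G (into T) u v a)
    (hb : NB G (into T) v u b) (hab : a + b ≤ L + 1) : M.Adj u v := by
  induction b using Nat.strong_induction_on with
  | _ b ih =>
  have hapos := ha.pos
  obtain ⟨p, t, ht, hd⟩ := hb.last
  rcases hd.rev.lollipop_of_nil with ⟨z, q, hq, -, hql, hqp, rfl⟩ |
    ⟨z, τ, c, hτ, hc, -, hl, h⟩
  · have huv : s(u, z) ∈ q.edges := by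
      rw [← hqp]
      refine Walk.mk_penultimate_end_mem_edges fun hn => ?_
      have := Walk.length_eq_zero_iff.2 hn
      have := hd.pos
      omega
    cases ha with
    | base h1 h2 => exact hM.path t ht z h2 q hq (by omega) u z huv
    | step h1 h2 h3 =>
      rcases h3.path_or_lollipop q hq (hqp ▸ h2.symm) with
        ⟨y, r, hr, hqr, -, hrl, hy⟩ | ⟨y, τ, c, hτ, hc, hsub, hl, -⟩
      · exact hM.path t ht y hy r hr (by omega) u z (hqr huv)
      · exact hM.lollipop t ht y τ c hτ hc (by omega) u z (hsub _ (.inl huv))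
  · rcases h with ⟨o, ho, rfl, rfl⟩ | ⟨y, k, hk, hkl⟩
    · exact hM.lollipop t ht z τ c hτ hc (by omega) _ _ (.inr ho)
    · have hc3 := hc.three_le_length
      have hk' : NB G (into {z}) v u k := hk.rev.mono le_rfl fun _ _ h => h.2
      by_cases hn : τ.Nil
      · obtain rfl := hn.eq
        exact ih k (by omega) (hk'.mono le_rfl (into_mono (Set.singleton_subset_iff.2 ht)))
          (by omega)
      · have hτM : ∀ e ∈ τ.reverse.edges, e ∈ M.edgeSet := by
          intro e he
          induction e with
          | _ x y => exact hM.lollipop t ht z τ c hτ hc (by omega) x y (.inl (by simpa using he))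
        have hnb := nb_of_isTrail (τ.reverse.transfer M hτM) (hτ.reverse.transfer _).isTrail
          (by rwa [← Walk.length_eq_zero_iff, Walk.length_transfer, Walk.length_reverse,
            Walk.length_eq_zero_iff])
        have hnb' : NB M (into T) z _ _ := hnb.mono le_rfl fun _ _ h => by
          rw [h.2]; exact ht
        rw [Walk.length_transfer, Walk.length_reverse] at hnb'
        rcases hnb'.splice_into hM.le hk' with ⟨k', hk'', h⟩ | ⟨i, -, h⟩
        · exact ih k' (by omega) h (by omega)
        · exact h.adj

theorem Confined.hull_le (hM : Confined G T M L) : hull G T L ≤ M :=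
  fun _ _ ⟨_, _, ha, hb, hab⟩ => hM.adj ha hb hab

end Confined

section Cycles

variable {V : Type*} {G : SimpleGraph V}

theorem exists_walks_around {s t u v : V} (p : G.Walk s t) (hp : p.IsTrail)
    (he : s(u, v) ∈ p.edges) : ∃ x y, s(x, y) = s(u, v) ∧ ∃ (q : G.Walk s x) (r : G.Walk y t),
      (∀ e, e ∈ q.edges ∨ e ∈ r.edges → e ∈ p.edges ∧ e ≠ s(u, v)) := by
  induction p with
  | nil => simp at he
  | @cons s w t h p ih =>
    have htr := (Walk.isTrail_cons _ _).1 hp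
    rw [Walk.edges_cons, List.mem_cons] at he
    rcases he with he | he
    · refine ⟨s, w, he.symm, .nil, p, ?_⟩
      rintro e (h1 | h1)
      · simp at h1
      · exact ⟨by simp [h1], fun h2 => htr.2 (by rwa [← he, ← h2])⟩
    · obtain ⟨x, y, hxy, q, r, hqr⟩ := ih htr.1 he
      refine ⟨x, y, hxy, .cons h q, r, ?_⟩
      rintro e (h1 | h1)
      · rw [Walk.edges_cons, List.mem_cons] at h1
        rcases h1 with rfl | h1
        · exact ⟨by simp, fun h2 => htr.2 (by rwa [h2])⟩
        · exact ⟨by simp [(hqr e (.inl h1)).1], (hqr e (.inl h1)).2⟩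
      · exact ⟨by simp [(hqr e (.inr h1)).1], (hqr e (.inr h1)).2⟩

theorem exists_walk_on_cycle {z s t : V} (c : G.Walk z z) (hs : s ∈ c.support)
    (ht : t ∈ c.support) : ∃ w : G.Walk s t, ∀ e ∈ w.edges, e ∈ c.edges := by
  classical
  refine ⟨(c.takeUntil s hs).reverse.append (c.takeUntil t ht), fun e he => ?_⟩
  rw [Walk.edges_append, List.mem_append, Walk.edges_reverse, List.mem_reverse] at he
  exact he.elim (fun h => c.edges_takeUntil_subset_edges hs h)
    fun h => c.edges_takeUntil_subset_edges ht h

/-- Cycles of length at most `a` at distance less than `a` coincide. -/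
def Sparse (G : SimpleGraph V) (a : ℕ) : Prop :=
  ∀ (x₁ x₂ : V) (w₁ : G.Walk x₁ x₁) (w₂ : G.Walk x₂ x₂), w₁.IsCycle → w₂.IsCycle →
    w₁.length ≤ a → w₂.length ≤ a → ∀ u ∈ w₁.support, ∀ v ∈ w₂.support, ∀ p : G.Walk u v,
      p.length < a → ∀ e, e ∈ w₁.edges ↔ e ∈ w₂.edges

/-- The vertices of a closed walk. -/
def verts {z : V} (c : G.Walk z z) : Set V := {v | v ∈ c.support}

/-- The edges of a closed walk. -/
def edgeGraph {z : V} (c : G.Walk z z) : SimpleGraph V where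
  Adj u v := s(u, v) ∈ c.edges
  symm := ⟨fun _ _ h => by rwa [Sym2.eq_swap]⟩
  loopless := ⟨fun _ h => G.loopless.irrefl _ (c.adj_of_mem_edges h)⟩

theorem path_edges_subset_cycle {a : ℕ} (hG : Sparse G a) {z : V} (c : G.Walk z z)
    (hc : c.IsCycle) {s t : V} (hs : s ∈ c.support) (ht : t ∈ c.support) (p : G.Walk s t)
    (hp : p.IsPath) (hl : p.length + c.length ≤ a) {u v : V} (he : s(u, v) ∈ p.edges) :
    s(u, v) ∈ c.edges := by
  classical
  by_contra hec
  obtain ⟨x, y, hxy, q, r, hqr⟩ := exists_walks_around p hp.isTrail he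
  obtain ⟨w, hw⟩ := exists_walk_on_cycle c hs ht
  have hc3 := hc.three_le_length
  have hadj : G.Adj y x := by
    have := p.adj_of_mem_edges (hxy ▸ he)
    exact this.symm
  let W := (q.reverse.append w).append r.reverse
  have hW : ∀ e ∈ W.edges, (e ∈ p.edges ∨ e ∈ c.edges) ∧ e ≠ s(u, v) := by
    intro e h
    simp only [W, Walk.edges_append, Walk.edges_reverse, List.mem_append, List.mem_reverse] at h
    rcases h with (h | h) | h
    · exact ⟨.inl (hqr e (.inl h)).1, (hqr e (.inl h)).2⟩
    · exact ⟨.inr (hw e h), fun h' => hec (h' ▸ hw e h)⟩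
    · exact ⟨.inl (hqr e (.inr h)).1, (hqr e (.inr h)).2⟩
  have hyx : s(y, x) = s(u, v) := by rw [Sym2.eq_swap, hxy]
  have hD : (Walk.cons hadj W.bypass).IsCycle := by
    rw [Walk.cons_isCycle_iff]
    exact ⟨W.bypass_isPath, fun h => (hW _ (W.edges_bypass_subset_edges h)).2 hyx⟩
  have hsub : (Walk.cons hadj W.bypass).edges ⊆ p.edges ++ c.edges := by
    intro e h
    rw [Walk.edges_cons, List.mem_cons] at h
    rw [List.mem_append]
    rcases h with rfl | h
    · exact .inl (hyx ▸ he)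
    · exact (hW _ (W.edges_bypass_subset_edges h)).1
  have hlen : (Walk.cons hadj W.bypass).length ≤ a := by
    have := (List.subperm_of_subset hD.edges_nodup hsub).length_le
    rw [Walk.length_edges, List.length_append, Walk.length_edges, Walk.length_edges] at this
    omega
  have hu : x ∈ p.support := p.fst_mem_support_of_mem_edges (hxy ▸ he)
  refine hec ((hG _ _ c _ hc hD (by omega) hlen s hs x (by simp) (p.takeUntil x hu) ?_ _).2
    (by simp [hyx]))
  have := p.length_takeUntil_le_length hu
  omega

theorem Sparse.confined {a L : ℕ} (hG : Sparse G a) {z : V} (c : G.Walk z z) (hc : c.IsCycle)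
    (hL : L + c.length ≤ a) : Confined G (verts c) (edgeGraph c) L where
  le := fun _ _ h => c.adj_of_mem_edges h
  path := fun s hs t ht p hp hl _ _ he =>
    path_edges_subset_cycle hG c hc hs ht p hp (by omega) he
  lollipop := by
    intro t ht y τ c' hτ hc' hl u v he
    have hc3 := hc.three_le_length
    have heq := hG _ _ c c' hc hc' (by omega) (by omega) t ht y (by simp) τ (by omega)
    refine he.elim (path_edges_subset_cycle hG c hc ht ?_ τ hτ (by omega)) (heq _).2
    have : s(y, c'.snd) ∈ c'.edges := Walk.mk_start_snd_mem_edges hc'.not_nil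
    exact c.fst_mem_support_of_mem_edges ((heq _).2 this)

theorem cycle_le_hull {z u v : V} (c : G.Walk z z) (hc : c.IsCycle) (h : s(u, v) ∈ c.edges) :
    (hull G {z} c.length).Adj u v :=
  trail_le_hull (Set.mem_singleton z) (Set.mem_singleton z) c hc.isTrail le_rfl h

end Cycles

section Core

variable {V : Type*} {G M : SimpleGraph V} {T : Set V} {L : ℕ}

/-- Pigeonhole: many walks from `z` into a small set close up to a walk at `z`. -/
theorem exists_closed {z : V} {Y W : Finset V} {d : ℕ} (hcard : Y.card < W.card)
    (hW : ∀ w ∈ W, ∃ k ≤ d, NB G (into (Y : Set V)) z w k) :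
    ∃ w ∈ W, ∃ k ≤ 2 * d, NB G (into {z}) z w k := by
  have h1 : ∀ w ∈ W, ∃ y ∈ Y, ∃ k ≤ d, NB G (into {y}) z w k := by
    intro w hw
    obtain ⟨k, hk, h⟩ := hW w hw
    obtain ⟨p, q, hq, h⟩ := h.last
    exact ⟨q, hq, k, hk, h.mono le_rfl fun _ _ h => h.2⟩
  choose! y hy h1 using h1
  obtain ⟨w, hw, w', hw', hne, heq⟩ :=
    Finset.exists_ne_map_eq_of_card_lt_of_maps_to hcard (f := y) hy
  obtain ⟨k, hk, h2⟩ := h1 w hw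
  obtain ⟨k', hk', h3⟩ := h1 w' hw'
  rw [← heq] at h3
  obtain ⟨v, hv, j, hj, h4⟩ := h2.zipper h3 hne
  exact ⟨v, by rcases hv with rfl | rfl <;> assumption, j, by omega, h4⟩

theorem Confined.false_of_mem (hM : Confined G T M L) {z : V} (hz : z ∈ T) {Y W : Finset V}
    {d : ℕ} (hL : 2 * d ≤ L) (hcard : Y.card < W.card)
    (hW : ∀ w ∈ W, ¬M.Adj z w ∧ ∃ k ≤ d, NB G (into (Y : Set V)) z w k) : False := by
  obtain ⟨w, hw, k, hk, h⟩ := exists_closed hcard fun w hw => (hW w hw).2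
  exact (hW w hw).1 (hM.adj (h.mono le_rfl (into_mono (Set.singleton_subset_iff.2 hz)))
    (.base h.adj.symm hz) (by omega))

theorem Confined.false_of_near (hM : Confined G T M L) {z r : V} (hz : z ∉ T) {Y W : Finset V}
    {d ρ : ℕ} (hr : NB G (into T) z r ρ) (hmin : ∀ r' k, NB G (into T) z r' k → ρ ≤ k)
    (hL : 2 * ρ + 2 * d ≤ L) (hcard : Y.card < W.card)
    (hW : ∀ w ∈ W, w ≠ r ∧ ¬M.Adj z w ∧ ∃ k ≤ d, NB G (into (Y : Set V)) z w k) : False := by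
  obtain ⟨w, hw, k, hk, h⟩ := exists_closed hcard fun w hw => (hW w hw).2.2
  have hpos := h.pos
  rcases hr.splice_into le_rfl h with ⟨c, hc, h1⟩ | ⟨i, hi, h1⟩
  · exact (hW w hw).2.1 (hM.adj h1 (.step h.adj.symm (hW w hw).1.symm hr) (by omega))
  · cases h1 with
    | base _ h2 => exact hz h2
    | step _ _ h2 =>
      have := hmin _ _ h2
      omega

theorem NB.into_union {Y S : Set V} {u v : V} {n : ℕ} (h : NB G (into (Y ∪ S)) u v n) :
    NB G (into Y) u v n ∨ NB G (into S) u v n := by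
  obtain ⟨p, q, hq, h⟩ := h.last
  rcases hq with hq | hq
  · exact .inl (h.mono le_rfl fun _ _ h => by rw [h.2]; exact hq)
  · exact .inr (h.mono le_rfl fun _ _ h => by rw [h.2]; exact hq)

theorem NB.exists_minimal {z r : V} {k : ℕ} {T : V → V → Prop} (h : NB G T z r k) :
    ∃ r' ρ, ρ ≤ k ∧ NB G T z r' ρ ∧ ∀ r' j, NB G T z r' j → ρ ≤ j := by
  classical
  have hex : ∃ ρ r', NB G T z r' ρ := ⟨k, r, h⟩
  obtain ⟨r', h'⟩ := Nat.find_spec hex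
  exact ⟨r', Nat.find hex, Nat.find_min' hex ⟨r, h⟩, h', fun r' j hj => Nat.find_min' hex ⟨r', hj⟩⟩

end Core

section Fresh

/-- The vertex set `[n]`. -/
def seg (n : ℕ) : Set ℕ := {v | v ∈ Finset.Icc 1 n}

/-- The hypotheses on a single graph. -/
structure Good (m a n₀ N₀ n : ℕ) (G : SimpleGraph ℕ) : Prop where
  three_le_m : 3 ≤ m
  three_le_a : 3 ≤ a
  le : n₀ ≤ N₀
  vert : ∀ u v : ℕ, G.Adj u v → u ∈ Finset.Icc 1 n ∧ v ∈ Finset.Icc 1 n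
  deg : ∀ v ∈ Finset.Icc 1 n, m ≤ ndeg G v
  q1 : PropQ1 G a n₀ N₀
  q2 : PropQ2 G a m N₀
  q3 : ∀ v ∈ Finset.Icc 1 N₀, N₀ + m ≤ ndeg G v

variable {m a n₀ N₀ n : ℕ} {G : SimpleGraph ℕ}

/-- The edges of `G` inside `[N₀]`. -/
def inner (G : SimpleGraph ℕ) (N₀ : ℕ) : SimpleGraph ℕ where
  Adj u v := G.Adj u v ∧ u ∈ Finset.Icc 1 N₀ ∧ v ∈ Finset.Icc 1 N₀
  symm := ⟨fun _ _ h => ⟨h.1.symm, h.2.2, h.2.1⟩⟩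
  loopless := ⟨fun _ h => G.loopless.irrefl _ h.1⟩

theorem Good.confined (hG : Good m a n₀ N₀ n G) :
    Confined G (seg n₀) (inner G N₀) (a - 1) where
  le := fun _ _ h => h.1
  path := fun s hs t ht p hp hl u v he => by
    have h3 := hG.three_le_a
    have := hG.q1.2.1 s t p hs ht hp (by simp; omega)
    exact ⟨p.adj_of_mem_edges he, this _ (p.fst_mem_support_of_mem_edges he),
      this _ (p.snd_mem_support_of_mem_edges he)⟩
  lollipop := fun t ht z τ c hτ hc hl u v he => by
    have h3 := hG.three_le_a
    have h4 := hc.three_le_length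
    rcases hG.q1.1 z c hc (by omega) with ⟨h1, h2⟩ | h1
    · rcases he with he | he
      · have := h2 t z τ ht (by simp) hτ (by omega)
        exact ⟨τ.adj_of_mem_edges he, this _ (τ.fst_mem_support_of_mem_edges he),
          this _ (τ.snd_mem_support_of_mem_edges he)⟩
      · exact ⟨c.adj_of_mem_edges he, h1 _ (c.fst_mem_support_of_mem_edges he),
          h1 _ (c.snd_mem_support_of_mem_edges he)⟩
    · have := h1 t ht z (by simp) τ
      omega

theorem Good.sparse (hG : Good m a n₀ N₀ n G) : Sparse (off G (seg n₀)) a := by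
  intro x₁ x₂ w₁ w₂ h1 h2 hl1 hl2 u hu v hv p hp e
  have key : ∀ {x} (w : (off G (seg n₀)).Walk x x), w.IsCycle → ∀ v ∈ (w.mapLe (off_le _)).support,
      v ∉ Finset.Icc 1 n₀ := by
    intro x w hw v hv
    rw [Walk.support_mapLe_eq_support] at hv
    have := hw.ncard_neighborSet_toSubgraph_eq_two hv
    obtain ⟨y, hy⟩ := Set.nonempty_of_ncard_ne_zero (this ▸ two_ne_zero)
    exact hy.adj_sub.2.1
  by_contra hne
  have := hG.q1.2.2 x₁ x₂ (w₁.mapLe (off_le _)) (w₂.mapLe (off_le _))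
    ((Walk.isCycle_mapLe _).2 h1) ((Walk.isCycle_mapLe _).2 h2)
    (by simpa using hl1) (by simpa using hl2) (key w₁ h1) (key w₂ h2) (fun h => hne ?_)
    u (by simpa using hu) v (by simpa using hv) (p.mapLe (off_le _))
  · simp at this; omega
  · simpa using Finset.ext_iff.1 h e

theorem Good.exists_outer (hG : Good m a n₀ N₀ n G) {z : ℕ} (hz : z ∈ Finset.Icc 1 n) :
    ∃ W : Finset ℕ, m ≤ W.card ∧ ∀ w ∈ W, G.Adj z w ∧ ¬(inner G N₀).Adj z w := by
  classical
  have hfin : {v | G.Adj z v}.Finite :=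
    (Finset.finite_toSet (Finset.Icc 1 n)).subset fun v hv => (hG.vert _ _ hv).2
  have hcard : hfin.toFinset.card = ndeg G z := (Set.ncard_eq_toFinset_card _ hfin).symm
  by_cases h : z ∈ Finset.Icc 1 N₀
  · refine ⟨hfin.toFinset \ Finset.Icc 1 N₀, ?_, fun w hw => ?_⟩
    · have h1 := Finset.le_card_sdiff (Finset.Icc 1 N₀) hfin.toFinset
      have h2 := hG.q3 z h
      rw [Nat.card_Icc] at h1
      omega
    · simp only [Finset.mem_sdiff, Set.Finite.mem_toFinset, Set.mem_ofPred_eq] at hw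
      exact ⟨hw.1, fun h => hw.2 h.2.2⟩
  · exact ⟨hfin.toFinset, hcard ▸ hG.deg z hz, fun w hw => ⟨by simpa using hw, fun h' => h h'.2.1⟩⟩

theorem card_filter_edgeGraph_le {V : Type*} {G : SimpleGraph V} {z x : V} (c : G.Walk x x)
    (hc : c.IsCycle) (W : Finset V) [DecidablePred fun w => (edgeGraph c).Adj z w] :
    (W.filter fun w => (edgeGraph c).Adj z w).card ≤ 2 := by
  by_cases hz : z ∈ c.support
  · have h2 := hc.ncard_neighborSet_toSubgraph_eq_two hz
    rw [← Set.ncard_coe_finset, ← h2]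
    refine Set.ncard_le_ncard (fun w hw => ?_) (Set.finite_of_ncard_ne_zero (h2 ▸ two_ne_zero))
    have : (edgeGraph c).Adj z w := by simpa using (Finset.mem_filter.1 hw).2
    exact Walk.adj_toSubgraph_iff_mem_edges.2 this
  · have : (W.filter fun w => (edgeGraph c).Adj z w) = ∅ :=
      Finset.filter_eq_empty_iff.2 fun _ _ h => hz (c.fst_mem_support_of_mem_edges h)
    simp [this]

/-- Every vertex has an edge outside the hull of `[n₀]` and few further vertices. -/
theorem Good.exists_fresh (hG : Good m a n₀ N₀ n G) {Y : Finset ℕ} (hY : Y.card + 3 ≤ m)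
    {z d : ℕ} (hz : z ∈ Finset.Icc 1 n) (hd : d < a) (hda : Y = ∅ ∨ 4 * d < a) :
    ∃ w, G.Adj z w ∧ ¬(hull G (Y ∪ seg n₀) d).Adj z w := by
  classical
  by_contra! hall
  obtain ⟨W, hWm, hW⟩ := hG.exists_outer hz
  rcases Y.eq_empty_or_nonempty with rfl | hne
  · obtain ⟨w, hw⟩ : W.Nonempty := Finset.card_pos.1 (by have := hG.three_le_m; omega)
    have h1 := hall w (hW w hw).1
    simp only [Finset.coe_empty, Set.empty_union] at h1
    exact (hW w hw).2 ((hG.confined.anti (by omega)).hull_le h1)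
  have hda : 4 * d < a := hda.resolve_left hne.ne_empty
  have hwalk : ∀ w ∈ W, ∃ k ≤ d, NB G (into (Y ∪ seg n₀)) z w k := fun w hw => by
    obtain ⟨i, j, hi, hj, hij⟩ := hall w (hW w hw).1
    have := hj.pos
    exact ⟨i, by omega, hi⟩
  by_cases hzN : z ∈ seg n₀
  · refine hG.confined.false_of_mem hzN (Y := Y) (W := W) (d := d) (by omega) (by omega)
      fun w hw => ⟨(hW w hw).2, ?_⟩
    obtain ⟨k, hk, h⟩ := hwalk w hw
    refine ⟨k, hk, h.into_union.resolve_right fun h => (hW w hw).2 ?_⟩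
    exact hG.confined.adj h (.base h.adj.symm hzN) (by omega)
  by_cases hnear : ∃ r, ∃ k ≤ d, NB G (into (seg n₀)) z r k
  · obtain ⟨r, k, hk, h⟩ := hnear
    obtain ⟨r, ρ, hρ, hr, hmin⟩ := h.exists_minimal
    refine hG.confined.false_of_near hzN hr hmin (Y := Y) (W := W.erase r) (d := d) (by omega) ?_
      fun w hw => ?_
    · have := Finset.pred_card_le_card_erase (s := W) (a := r)
      omega
    · obtain ⟨hwr, hw⟩ := Finset.mem_erase.1 hw
      obtain ⟨i, hi, h⟩ := hwalk w hw
      refine ⟨hwr, (hW w hw).2, i, hi, h.into_union.resolve_right fun h => (hW w hw).2 ?_⟩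
      exact hG.confined.adj h (.step h.adj.symm hwr.symm hr) (by omega)
  · have hwalk' : ∀ w ∈ W, ∃ k ≤ d, NB (off G (seg n₀)) (into (Y : Set ℕ)) z w k := by
      intro w hw
      obtain ⟨k, hk, h⟩ := hwalk w hw
      refine ⟨k, hk, (h.avoid (T' := into (Y : Set ℕ)) ?_ hzN).resolve_left ?_⟩
      · exact fun u v h1 h2 => h1.resolve_right h2
      · rintro ⟨c, hc, h⟩
        exact hnear ⟨w, c, by omega, h⟩
    obtain ⟨w, hw, k, hk, h⟩ := exists_closed (by omega : Y.card < W.card) hwalk'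
    obtain ⟨p, τ, c, hc, hl⟩ := h.exists_cycle
    have hconf := hG.sparse.confined (L := a - c.length) c hc (by omega)
    by_cases hzc : z ∈ verts c
    · refine hconf.false_of_mem hzc (Y := Y) (W := W.filter fun w => ¬(edgeGraph c).Adj z w)
        (d := d) (by omega) ?_ fun w hw => ?_
      · have h1 := card_filter_edgeGraph_le c hc (z := z) W
        have h2 := W.card_filter_add_card_filter_not (p := fun w => (edgeGraph c).Adj z w)
        omega
      · obtain ⟨hw, hwc⟩ := Finset.mem_filter.1 hw
        exact ⟨hwc, hwalk' w hw⟩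
    · obtain ⟨r, j, hj, hr⟩ := (nb_of_walk (S := verts c) τ c.start_mem_support).resolve_left hzc
      obtain ⟨r, ρ, hρ, hr, hmin⟩ := hr.exists_minimal
      refine hconf.false_of_near hzc hr hmin (Y := Y) (W := W.erase r) (d := d) (by omega) ?_
        fun w hw => ?_
      · have := Finset.pred_card_le_card_erase (s := W) (a := r)
        omega
      · obtain ⟨hwr, hw⟩ := Finset.mem_erase.1 hw
        exact ⟨hwr, fun h => hzc (c.fst_mem_support_of_mem_edges h), hwalk' w hw⟩

end Fresh

section Extend

variable {V : Type*} {G H A B : SimpleGraph V} {S : Set V} {d d' : ℕ}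

/-- A short walk from a vertex that already meets the hull starts inside the hull. -/
theorem NB.adj_hull {p q : V} {k : ℕ} (h : NB G (into S) p q k) (hk : k ≤ d') (hd : 2 * d' ≤ d)
    (hp : (p ∈ S ∨ ∃ r, (hull G S d).Adj p r) ∨ ∃ r ≠ q, ∃ i ≤ d', NB G (into S) p r i) :
    (hull G S d).Adj p q := by
  have hkpos := h.pos
  rcases hp with (hp | ⟨r, i, j, hi, hj, hij⟩) | ⟨r, hr, i, hi, h'⟩
  · exact ⟨k, 1, h, .base h.adj.symm hp, by omega⟩
  · rcases eq_or_ne r q with rfl | hne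
    · exact ⟨i, j, hi, hj, hij⟩
    · by_cases hid : i ≤ d'
      · exact ⟨k, i + 1, h, .step h.adj.symm hne hi, by omega⟩
      · cases hj with
        | base _ h2 => exact ⟨k, 1, h, .base h.adj.symm h2, by omega⟩
        | @step _ _ p₂ j h1 h2 h3 =>
          rcases eq_or_ne p₂ q with rfl | hne'
          · exact ⟨j, i + 1, h3, .step h.adj.symm hne hi, by omega⟩
          · exact ⟨k, j + 1, h, .step h.adj.symm hne' h3, by omega⟩
  · exact ⟨k, i + 1, h, .step h.adj.symm hr h', by omega⟩

theorem Carries.sup {f : V ≃ V} {A' B' : SimpleGraph V} (h : Carries f A B)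
    (h' : Carries f A' B') : Carries f (A ⊔ A') (B ⊔ B') := fun u v => by
  rw [sup_adj, sup_adj, h u v, h' u v]

theorem carries_edge (f : V ≃ V) (p q : V) : Carries f (edge p q) (edge (f p) (f q)) :=
  fun u v => by simp [edge_adj]

/-- Two isolated vertices may be swapped. -/
theorem Carries.swap [DecidableEq V] {f : V ≃ V} (h : Carries f A B) {p y : V}
    (hp : ∀ r, ¬B.Adj p r) (hy : ∀ r, ¬B.Adj y r) : Carries (f.trans (Equiv.swap p y)) A B := by
  intro u v
  rw [h u v]
  have hp' : ∀ r, ¬B.Adj r p := fun r h => hp r h.symm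
  have hy' : ∀ r, ¬B.Adj r y := fun r h => hy r h.symm
  simp only [Equiv.trans_apply, Equiv.swap_apply_def]
  split_ifs <;> simp_all

/-- Graphs between the hulls and the ambient graphs that `g` identifies; every vertex of theirs
outside the hulls reaches the pebbles within `j` steps. -/
structure Frame (G H : SimpleGraph V) (S : Set V) (f : V ≃ V) (d j : ℕ) (A B : SimpleGraph V)
    (g : V ≃ V) : Prop where
  hullA : hull G S d ≤ A
  le_G : A ≤ G
  hullB : hull H (f '' S) d ≤ B
  le_H : B ≤ H
  carries : Carries g A B
  agree : ∀ s ∈ S, g s = f s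
  suppA : ∀ v r, A.Adj v r → (v ∈ S ∨ ∃ r, (hull G S d).Adj v r) ∨
    ∃ r, ∃ i ≤ j, NB A (into S) v r i
  suppB : ∀ v r, B.Adj v r → (v ∈ f '' S ∨ ∃ r, (hull H (f '' S) d).Adj v r) ∨
    ∃ r, ∃ i ≤ j, NB B (into (f '' S)) v r i

variable {f g : V ≃ V} {j : ℕ}

theorem Frame.image (h : Frame G H S f d j A B g) : g '' S = f '' S :=
  Set.image_congr fun s hs => h.agree s hs

theorem Frame.nb (h : Frame G H S f d j A B g) {u v : V} {n : ℕ} (hu : NB A (into S) u v n) :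
    NB B (into (f '' S)) (g u) (g v) n :=
  h.image ▸ h.carries.nb hu

/-- A frame extends by one pendant edge. -/
theorem Frame.extend (h : Frame G H S f d j A B g) (hd : 2 * d' ≤ d) (hj : j + 1 ≤ d')
    {q q₁ y : V} (hq : G.Adj q q₁) (hqA : ¬A.Adj q q₁) (hy : H.Adj (g q₁) y)
    (hyB : ¬B.Adj (g q₁) y)
    (hq₁ : (q₁ ∈ S ∧ j = 0) ∨ ∃ w, w ≠ q ∧ NB A (into S) q₁ w j) :
    ∃ A' B' g', Frame G H S f d (j + 1) A' B' g' ∧ NB A' (into S) q q₁ (j + 1) ∧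
      (∀ r, A'.Adj q r → r = q₁) ∧ (∀ r, B'.Adj (g' q) r → r = g' q₁) := by
  classical
  have hq₁B : (g q₁ ∈ f '' S ∧ j = 0) ∨ ∃ w, w ≠ y ∧ NB B (into (f '' S)) (g q₁) w j := by
    rcases hq₁ with ⟨h1, h2⟩ | ⟨w, h1, h2⟩
    · exact .inl ⟨h.image ▸ ⟨_, h1, rfl⟩, h2⟩
    · refine .inr ⟨g w, ?_, h.nb h2⟩
      rintro rfl
      exact hyB (h.nb h2).adj
  have reach : ∀ {C : SimpleGraph V} {T : Set V} {p p₁ : V}, C.Adj p p₁ →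
      ((p₁ ∈ T ∧ j = 0) ∨ ∃ w, w ≠ p ∧ NB C (into T) p₁ w j) → NB C (into T) p p₁ (j + 1) := by
    rintro C T p p₁ hC (⟨h1, rfl⟩ | ⟨w, h1, h2⟩)
    · exact .base hC h1
    · exact .step hC h1 h2
  have lift : ∀ {C C' : SimpleGraph V} {T : Set V} {p p₁ : V}, C ≤ C' →
      ((p₁ ∈ T ∧ j = 0) ∨ ∃ w, w ≠ p ∧ NB C (into T) p₁ w j) →
      ((p₁ ∈ T ∧ j = 0) ∨ ∃ w, w ≠ p ∧ NB C' (into T) p₁ w j) := fun hC h =>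
    h.imp_right fun ⟨w, h1, h2⟩ => ⟨w, h1, h2.mono hC fun _ _ => id⟩
  have hqG := reach hq (lift h.le_G hq₁)
  have hyH := reach hy.symm (lift h.le_H hq₁B)
  have hqS : ¬((q ∈ S ∨ ∃ r, (hull G S d).Adj q r) ∨ ∃ r ≠ q₁, ∃ i ≤ d', NB G (into S) q r i) :=
    fun hc => hqA (h.hullA (hqG.adj_hull hj hd hc))
  have hyS : ¬((y ∈ f '' S ∨ ∃ r, (hull H (f '' S) d).Adj y r) ∨
      ∃ r ≠ g q₁, ∃ i ≤ d', NB H (into (f '' S)) y r i) :=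
    fun hc => hyB (h.hullB (hyH.adj_hull hj hd hc)).symm
  have hqA' : ∀ r, ¬A.Adj q r := fun r hr => hqS <| (h.suppA q r hr).imp_right
    fun ⟨r, i, hi, h1⟩ => ⟨r, fun h2 => hqA (h2 ▸ h1.adj), i, by omega,
      h1.mono h.le_G fun _ _ => id⟩
  have hyB' : ∀ r, ¬B.Adj y r := fun r hr => hyS <| (h.suppB y r hr).imp_right
    fun ⟨r, i, hi, h1⟩ => ⟨r, fun h2 => hyB (h2 ▸ h1.adj).symm, i, by omega,
      h1.mono h.le_H fun _ _ => id⟩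
  have hgqB : ∀ r, ¬B.Adj (g q) r := fun r hr => hqA' (g.symm r) ((h.carries _ _).2 (by simpa))
  let g' := g.trans (Equiv.swap (g q) y)
  have hg'q : g' q = y := by simp [g']
  have hg'q₁ : g' q₁ = g q₁ := by
    simp only [g', Equiv.trans_apply]
    exact Equiv.swap_apply_of_ne_of_ne (g.injective.ne hq.ne') hy.ne
  have hcar : Carries g' (A ⊔ edge q q₁) (B ⊔ edge y (g q₁)) := by
    have := (h.carries.swap hgqB hyB').sup (carries_edge g' q q₁)
    rwa [hg'q, hg'q₁] at this
  have hA : A ≤ A ⊔ edge q q₁ := le_sup_left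
  have hB : B ≤ B ⊔ edge y (g q₁) := le_sup_left
  have hadjA : (A ⊔ edge q q₁).Adj q q₁ := by simp [sup_adj, edge_adj, hq.ne]
  have hadjB : (B ⊔ edge y (g q₁)).Adj y (g q₁) := by simp [sup_adj, edge_adj, hy.ne']
  have hnbA := reach hadjA (lift hA hq₁)
  have hnbB := reach hadjB (lift hB hq₁B)
  refine ⟨A ⊔ edge q q₁, B ⊔ edge y (g q₁), g', ⟨h.hullA.trans hA, sup_le h.le_G ?_,
    h.hullB.trans hB, sup_le h.le_H ?_, hcar, ?_, ?_, ?_⟩, hnbA, ?_, ?_⟩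
  · exact (edge_le_iff _).2 (.inr hq)
  · exact (edge_le_iff _).2 (.inr hy.symm)
  · intro s hs
    rw [← h.agree s hs]
    refine Equiv.swap_apply_of_ne_of_ne (g.injective.ne ?_) ?_
    · rintro rfl
      exact hqS (.inl (.inl hs))
    · rintro rfl
      exact hyS (.inl (.inl (h.image ▸ ⟨s, hs, rfl⟩)))
  · intro v r hv
    rw [sup_adj, edge_adj] at hv
    rcases hv with hv | ⟨⟨rfl, rfl⟩ | ⟨rfl, rfl⟩, -⟩
    · exact (h.suppA v r hv).imp_right fun ⟨r, i, hi, h1⟩ =>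
        ⟨r, i, by omega, h1.mono hA fun _ _ => id⟩
    · exact .inr ⟨_, _, le_rfl, hnbA⟩
    · rcases lift hA hq₁ with h1 | ⟨w, -, h1⟩
      · exact .inl (.inl h1.1)
      · exact .inr ⟨w, j, by omega, h1⟩
  · intro v r hv
    rw [sup_adj, edge_adj] at hv
    rcases hv with hv | ⟨⟨rfl, rfl⟩ | ⟨rfl, rfl⟩, -⟩
    · exact (h.suppB v r hv).imp_right fun ⟨r, i, hi, h1⟩ =>
        ⟨r, i, by omega, h1.mono hB fun _ _ => id⟩
    · exact .inr ⟨_, _, le_rfl, hnbB⟩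
    · rcases lift hB hq₁B with h1 | ⟨w, -, h1⟩
      · exact .inl (.inl h1.1)
      · exact .inr ⟨w, j, by omega, h1⟩
  · intro r hr
    rw [sup_adj, edge_adj] at hr
    rcases hr with hr | ⟨⟨h1, h2⟩ | ⟨h1, h2⟩, -⟩
    · exact absurd hr (hqA' r)
    · exact h2
    · exact absurd h1 hq.ne
  · intro r hr
    rw [hg'q, sup_adj, edge_adj] at hr
    rcases hr with hr | ⟨⟨h1, h2⟩ | ⟨h1, h2⟩, -⟩
    · exact absurd hr (hyB' r)
    · rw [hg'q₁]
      exact h2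
    · exact absurd h1 hy.ne'

/-- A walk into the pebbles can be copied to the other graph. -/
theorem exists_frame (hf : Carries f (hull G S d) (hull H (f '' S) d)) (hd : 2 * d' ≤ d)
    (hfresh : ∀ z, (z ∈ f '' S ∨ ∃ r, ∃ i, i < d' ∧ NB H (into (f '' S)) z r i) →
      (∃ w, H.Adj z w ∧ ¬(hull H (f '' S) d).Adj z w) ∧ ∀ u, ∃ w ≠ u, H.Adj z w)
    {q q₁ : V} {j : ℕ} (h : NB G (into S) q q₁ j) (hj : j ≤ d') :
    ∃ A B g, Frame G H S f d j A B g ∧ NB A (into S) q q₁ j ∧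
      ((A = hull G S d ∧ B = hull H (f '' S) d) ∨
        (∀ r, A.Adj q r → r = q₁) ∧ ∀ r, B.Adj (g q) r → r = g q₁) := by
  have h0 : ∀ j, Frame G H S f d j (hull G S d) (hull H (f '' S) d) f := fun j =>
    ⟨le_rfl, hull_le _ _, le_rfl, hull_le _ _, hf, fun _ _ => rfl,
      fun v r h => .inl (.inr ⟨r, h⟩), fun v r h => .inl (.inr ⟨r, h⟩)⟩
  induction h with
  | @base q q₁ h1 h2 =>
    by_cases hq : (hull G S d).Adj q q₁
    · exact ⟨_, _, f, h0 1, .base hq h2, .inl ⟨rfl, rfl⟩⟩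
    · obtain ⟨y, hy, hyB⟩ := (hfresh (f q₁) (.inl ⟨_, h2, rfl⟩)).1
      obtain ⟨A', B', g', h3, h4, h5⟩ := (h0 0).extend hd hj h1 hq hy hyB (.inl ⟨h2, rfl⟩)
      exact ⟨A', B', g', h3, h4, .inr h5⟩
  | @step q q₁ w j h1 h2 h3 ih =>
    obtain ⟨A, B, g, hF, hnb, hphase⟩ := ih (by omega)
    by_cases hq : A.Adj q q₁
    · rcases hphase with hphase | hphase
      · obtain ⟨rfl, rfl⟩ := hphase
        exact ⟨_, _, g, ⟨le_rfl, hF.le_G, le_rfl, hF.le_H, hF.carries, hF.agree,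
          fun v r h => .inl (.inr ⟨r, h⟩), fun v r h => .inl (.inr ⟨r, h⟩)⟩,
          .step hq h2 hnb, .inl ⟨rfl, rfl⟩⟩
      · exact absurd (hphase.1 q hq.symm).symm h2
    · obtain ⟨hfr, hdeg⟩ := hfresh (g q₁)
        (.inr ⟨_, j, by omega, (hF.nb hnb).mono hF.le_H fun _ _ => id⟩)
      obtain ⟨y, hy, hyB⟩ : ∃ y, H.Adj (g q₁) y ∧ ¬B.Adj (g q₁) y := by
        rcases hphase with ⟨-, rfl⟩ | hphase
        · exact hfr
        · obtain ⟨y, hy, hadj⟩ := hdeg (g w)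
          exact ⟨y, hadj, fun h => hy (hphase.2 y h)⟩
      obtain ⟨A', B', g', h3, h4, h5⟩ := hF.extend hd hj h1 hq hy hyB (.inr ⟨w, h2, hnb⟩)
      exact ⟨A', B', g', h3, h4, .inr h5⟩

/-- A graph containing the hull and a walk from `x` contains the smaller hull with `x` added. -/
theorem hull_insert_le (hA : hull G S d ≤ A) (hAG : A ≤ G) {x x₁ : V} {h : ℕ}
    (hx : NB A (into S) x x₁ h) (hh : h ≤ d') (hd : 2 * d' ≤ d) (hd3 : 2 ≤ d' → 3 * d' ≤ d) :
    hull G (S ∪ {x}) d' ≤ A := by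
  rintro u v ⟨a, b, ha, hb, hab⟩
  have hpos := hx.pos
  have hapos := ha.pos
  have hbpos := hb.pos
  have key : ∀ {u v : V} {a : ℕ}, NB G (into (S ∪ {x})) u v a → a ≤ d' →
      (∃ c, (c ≤ a + h ∧ (a = 1 → v ≠ x → c = 1)) ∧ NB G (into S) u v c) ∨ A.Adj v u := by
    intro u v a ha had
    have hapos := ha.pos
    rcases ha.into_union with h1 | h1
    · exact .inl ⟨a, ⟨by omega, by simp +contextual⟩, h1⟩
    · rcases hx.splice_into hAG h1 with ⟨c, hc, h2⟩ | ⟨i, -, h2⟩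
      · refine .inl ⟨c, ⟨hc, ?_⟩, h2⟩
        rintro rfl hne
        cases h1 with
        | base _ h3 => exact absurd h3 hne
        | step _ _ h3 => exact absurd h3.pos (by omega)
      · exact .inr h2.adj
  rcases key ha (by omega) with ⟨c, ⟨hc, hc1⟩, h1⟩ | h1
  · rcases key hb (by omega) with ⟨e, ⟨he, he1⟩, h2⟩ | h2
    · refine hA ⟨c, e, h1, h2, ?_⟩
      by_cases h2' : 2 ≤ d'
      · have := hd3 h2'
        omega
      · have ha1 : a = 1 := by omega
        have hb1 : b = 1 := by omega
        by_cases hvx : v = x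
        · have := he1 hb1 (fun hux => h1.adj.ne (hux.trans hvx.symm))
          omega
        · have := hc1 ha1 hvx
          omega
    · exact h2
  · exact h1.symm

/-- The back-and-forth step for a vertex close to the pebbles. -/
theorem exists_near_answer (hf : Carries f (hull G S d) (hull H (f '' S) d)) (hd : 2 * d' ≤ d)
    (hd3 : 2 ≤ d' → 3 * d' ≤ d)
    (hfresh : ∀ z, (z ∈ f '' S ∨ ∃ r, ∃ i, i < d' ∧ NB H (into (f '' S)) z r i) →
      (∃ w, H.Adj z w ∧ ¬(hull H (f '' S) d).Adj z w) ∧ ∀ u, ∃ w ≠ u, H.Adj z w)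
    {x : V} (hx : Near G S x d') :
    ∃ g : V ≃ V, (∀ s ∈ S, g s = f s) ∧ Near H (f '' S) (g x) d' ∧
      Carries g (hull G (S ∪ {x}) d') (hull H (g '' (S ∪ {x})) d') := by
  rcases hx with hx | ⟨r, k, hk, h⟩
  · refine ⟨f, fun _ _ => rfl, .inl ⟨x, hx, rfl⟩, ?_⟩
    rw [Set.union_eq_self_of_subset_right (Set.singleton_subset_iff.2 hx)]
    exact hf.hull (hull_le _ _) (hull_le _ _) (hull_mono le_rfl subset_rfl (by omega))
      (hull_mono le_rfl subset_rfl (by omega))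
  · obtain ⟨A, B, g, hF, hnb, -⟩ := exists_frame hf hd hfresh h hk
    refine ⟨g, hF.agree, .inr ⟨g r, k, hk, (hF.nb hnb).mono hF.le_H fun _ _ => id⟩,
      hF.carries.hull hF.le_G hF.le_H (hull_insert_le hF.hullA hF.le_G hnb hk hd hd3) ?_⟩
    rw [Set.image_union, hF.image, Set.image_singleton]
    exact hull_insert_le hF.hullB hF.le_H (hF.nb hnb) hk hd hd3

end Extend

section Glue

variable {V : Type*} {G H : SimpleGraph V} {S : Set V} {d d' : ℕ}

theorem Near.exists_walk {x : V} (h : Near G S x d) : ∃ s ∈ S, ∃ w : G.Walk x s, w.length ≤ d := by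
  rcases h with h | ⟨r, k, hk, h⟩
  · exact ⟨x, h, .nil, by simp⟩
  · obtain ⟨p, s, hs, w, hw⟩ := h.toWalk
    exact ⟨s, hs, .cons h.adj w, by simp; omega⟩

theorem Near.mono {S' : Set V} (hS : S ⊆ S') (hd : d ≤ d') {x : V} (h : Near G S x d) :
    Near G S' x d' := by
  rcases h with h | ⟨r, k, hk, h⟩
  · exact .inl (hS h)
  · exact .inr ⟨r, k, by omega, h.mono le_rfl (into_mono hS)⟩

theorem exists_perm_extending (U : Finset V) (h : V → V) (hU : Set.InjOn h U) :
    ∃ e : V ≃ V, ∀ u ∈ U, e u = h u := by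
  classical
  induction U using Finset.induction_on with
  | empty => exact ⟨Equiv.refl V, by simp⟩
  | insert u U hu ih =>
    obtain ⟨e, he⟩ := ih (hU.mono (by simp))
    refine ⟨e.trans (Equiv.swap (e u) (h u)), fun v hv => ?_⟩
    rcases Finset.mem_insert.1 hv with rfl | hv'
    · simp
    · have hne : v ≠ u := by rintro rfl; exact hu hv'
      rw [Equiv.trans_apply, he v hv']
      refine Equiv.swap_apply_of_ne_of_ne ?_ ?_
      · rw [← he v hv']
        exact e.injective.ne hne
      · exact fun h' => hne (hU (by simp [hv']) (by simp) h')

theorem Carries.congr {A B : SimpleGraph V} {f e : V ≃ V} (h : Carries f A B)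
    (he : ∀ v r, A.Adj v r → e v = f v) : Carries e A B := by
  intro u v
  constructor
  · intro huv
    rw [he u v huv, he v u huv.symm]
    exact (h u v).1 huv
  · intro huv
    have h1 : A.Adj (f.symm (e u)) (f.symm (e v)) := (h _ _).2 (by simpa using huv)
    have h2 := he _ _ h1
    have h3 := he _ _ h1.symm
    rw [Equiv.apply_symm_apply] at h2 h3
    rwa [e.injective h2, e.injective h3] at h1

theorem hull_exists_walk {v r : V} (h : (hull G S d).Adj v r) :
    ∃ s ∈ S, ∃ w : G.Walk v s, 2 * w.length ≤ d := by
  obtain ⟨i, j, hi, hj, hij⟩ := h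
  obtain ⟨_, s, hs, w, hw⟩ := hi.toWalk
  obtain ⟨_, s', hs', w', hw'⟩ := hj.toWalk
  rcases le_total i (j - 1) with hle | hle
  · exact ⟨s, hs, .cons hi.adj w, by simp; omega⟩
  · exact ⟨s', hs', w', by omega⟩

theorem hull_insert_far {x : V} (hx : ¬Near G S x d) :
    hull G (S ∪ {x}) d = hull G S d ⊔ hull G {x} d := by
  refine le_antisymm ?_ (sup_le (hull_mono le_rfl Set.subset_union_left le_rfl)
    (hull_mono le_rfl Set.subset_union_right le_rfl))
  rintro u v ⟨a, b, ha, hb, hab⟩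
  rcases ha.into_union with h1 | h1 <;> rcases hb.into_union with h2 | h2
  · exact .inl ⟨a, b, h1, h2, hab⟩
  · obtain ⟨r, h3⟩ := h2.join h1
    exact absurd (.inr ⟨r, _, by omega, h3⟩) hx
  · obtain ⟨r, h3⟩ := h1.join h2
    exact absurd (.inr ⟨r, _, by omega, h3⟩) hx
  · exact .inr ⟨a, b, h1, h2, hab⟩

/-- Isomorphisms of the hulls of `S` and of a far vertex `x` combine. -/
theorem exists_glue {f g : V ≃ V} {x : V} {F : Set V} (hF : F.Finite)
    (hV : ∀ u v, G.Adj u v → u ∈ F) (hS : S ⊆ F) (hxF : x ∈ F)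
    (hf : Carries f (hull G S d) (hull H (f '' S) d))
    (hg : Carries g (hull G {x} d) (hull H {g x} d))
    (hx : ¬Near G S x d) (hy : ¬Near H (f '' S) (g x) d) :
    ∃ e : V ≃ V, (∀ s ∈ S, e s = f s) ∧ e x = g x ∧
      Carries e (hull G (S ∪ {x}) d) (hull H (e '' (S ∪ {x})) d) := by
  classical
  let P : SimpleGraph V → Set V → Set V := fun G S => S ∪ {v | ∃ r, (hull G S d).Adj v r}
  have hPF : P G S ⊆ F := Set.union_subset hS fun v ⟨r, h⟩ => hV v r (hull_le _ _ h)
  have hQF : P G {x} ⊆ F := Set.union_subset (Set.singleton_subset_iff.2 hxF)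
    fun v ⟨r, h⟩ => hV v r (hull_le _ _ h)
  have hwalk : ∀ {G : SimpleGraph V} {S : Set V} {v}, v ∈ P G S →
      ∃ s ∈ S, ∃ w : G.Walk v s, 2 * w.length ≤ d := by
    rintro G S v (hv | ⟨r, h⟩)
    · exact ⟨v, hv, .nil, by simp⟩
    · exact hull_exists_walk h
  have hdisj : ∀ {G : SimpleGraph V} {S : Set V} {x v}, ¬Near G S x d → v ∈ P G S →
      v ∉ P G {x} := by
    intro G S x v hx h1 h2
    obtain ⟨s, hs, w, hw⟩ := hwalk h1
    obtain ⟨_, rfl, w', hw'⟩ := hwalk h2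
    refine hx ((nb_of_walk (w'.reverse.append w) hs).imp_right fun ⟨r, k, hk, h⟩ => ⟨r, k, ?_, h⟩)
    simp at hk
    omega
  have hfP : ∀ {v}, v ∈ P G S → f v ∈ P H (f '' S) := fun hv =>
    hv.imp (fun h => ⟨_, h, rfl⟩) fun ⟨r, h⟩ => ⟨f r, (hf _ _).1 h⟩
  have hgP : ∀ {v}, v ∈ P G {x} → g v ∈ P H {g x} := fun hv =>
    hv.imp (fun h => congrArg g h) fun ⟨r, h⟩ => ⟨g r, (hg _ _).1 h⟩
  have hfin : (P G S ∪ P G {x}).Finite := hF.subset (Set.union_subset hPF hQF)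
  obtain ⟨e, he⟩ := exists_perm_extending hfin.toFinset
    (fun v => if v ∈ P G S then f v else g v) (by
    intro u hu v hv huv
    simp only [Set.Finite.coe_toFinset] at hu hv
    by_cases h1 : u ∈ P G S <;> by_cases h2 : v ∈ P G S <;>
      simp only [h1, h2, if_true, if_false] at huv
    · exact f.injective huv
    · exact absurd (huv ▸ hfP h1) (fun h => hdisj hy h (hgP (hv.resolve_left h2)))
    · exact absurd (huv ▸ hfP h2) (fun h => hdisj hy h (hgP (hu.resolve_left h1)))
    · exact g.injective huv)
  have he1 : ∀ v ∈ P G S, e v = f v := fun v hv => by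
    rw [he v (by simp [hv]), if_pos hv]
  have he2 : ∀ v ∈ P G {x}, e v = g v := fun v hv => by
    rw [he v (by simp [hv]), if_neg fun h => hdisj hx h hv]
  have hex : e x = g x := he2 x (.inl rfl)
  refine ⟨e, fun s hs => he1 s (.inl hs), hex, ?_⟩
  rw [Set.image_union, Set.image_singleton, hex, Set.image_congr fun s hs => he1 s (.inl hs),
    hull_insert_far hx, hull_insert_far hy]
  exact (hf.congr fun v r h => he1 v (.inr ⟨r, h⟩)).sup (hg.congr fun v r h => he2 v (.inr ⟨r, h⟩))

theorem hull_off {N : Set V} {x : V} (hx : ¬Near G N x d) :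
    hull (off G N) {x} d = hull G {x} d := by
  refine le_antisymm (hull_mono (off_le _) subset_rfl le_rfl) ?_
  have key : ∀ {u v a b}, NB G (into {x}) u v a → NB G (into {x}) v u b → a + b ≤ d + 1 →
      NB (off G N) (into {x}) u v a := by
    intro u v a b ha hb hab
    have := hb.pos
    have hu : u ∉ N := fun hu => by
      obtain ⟨r, h⟩ := ha.join (NB.base (T := into N) ha.adj.symm hu)
      exact hx (.inr ⟨r, _, by omega, h⟩)
    refine (ha.avoid (T' := into {x}) (fun _ _ h _ => h) hu).resolve_left ?_
    rintro ⟨c, hc, h⟩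
    obtain ⟨r, h⟩ := hb.join h
    exact hx (.inr ⟨r, _, by omega, h⟩)
  rintro u v ⟨a, b, ha, hb, hab⟩
  exact ⟨a, b, key ha hb hab, key hb ha (by omega), hab⟩

theorem hull_eq_bot {x : V} (h : ∀ r k, NB G (into {x}) x r k → d < k) : hull G {x} d = ⊥ := by
  refine le_bot_iff.1 ?_
  rintro u v ⟨a, b, ha, hb, hab⟩
  obtain ⟨r, h1⟩ := hb.join ha
  have := h _ _ h1
  omega

/-- Cycles of equal length are isomorphic. -/
theorem exists_cycle_iso {p p' : V} (c : G.Walk p p) (c' : H.Walk p' p') (hc : c.IsCycle)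
    (hc' : c'.IsCycle) (hl : c.length = c'.length) :
    ∃ f : V ≃ V, f p = p' ∧ Carries f (edgeGraph c) (edgeGraph c') := by
  classical
  have h3 := hc.three_le_length
  choose! idx hidx using fun (v : V) (hv : v ∈ c.support) =>
    (show ∃ i, i ≤ c.length - 1 ∧ c.getVert i = v by
      obtain ⟨i, hi, hil⟩ := Walk.mem_support_iff_exists_getVert.1 hv
      by_cases h : i ≤ c.length - 1
      · exact ⟨i, h, hi⟩
      · refine ⟨0, by omega, ?_⟩
        have : i = c.length := by omega
        rw [← hi, this]
        simp)
  obtain ⟨f, hf⟩ := exists_perm_extending c.support.toFinset (fun v => c'.getVert (idx v)) (by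
    intro u hu v hv huv
    simp only [List.coe_toFinset, Set.mem_ofPred_eq] at hu hv
    have := hc'.getVert_injOn' (by have := (hidx u hu).1; simp; omega)
      (by have := (hidx v hv).1; simp; omega) huv
    rw [← (hidx u hu).2, this, (hidx v hv).2])
  have hvert : ∀ i ≤ c.length, f (c.getVert i) = c'.getVert i := by
    intro i hi
    rw [hf _ (by simp)]
    obtain ⟨h1, h2⟩ := hidx (c.getVert i) (by simp)
    by_cases h : i ≤ c.length - 1
    · rw [hc.getVert_injOn' (by simpa using h1) (by simpa using h) h2]
    · have : i = c.length := by omega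
      subst this
      have h4 : c.getVert (idx (c.getVert c.length)) = c.getVert 0 := by rw [h2]; simp
      rw [hc.getVert_injOn' (by simpa using h1) (by simp) h4, hl]
      simp
  refine ⟨f, by simpa using hvert 0 (by omega), fun u v => ?_⟩
  have h5 : ∀ i < c.length, s(c'.getVert i, c'.getVert (i + 1)) =
      Sym2.map f s(c.getVert i, c.getVert (i + 1)) := fun i hi => by
    rw [Sym2.map_mk, hvert i (by omega), hvert (i + 1) (by omega)]
  change s(u, v) ∈ c.edges ↔ s(f u, f v) ∈ c'.edges
  rw [Walk.mk_mem_edges_iff_exists, Walk.mk_mem_edges_iff_exists, ← hl]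
  refine exists_congr fun i => and_congr_right fun hi => ?_
  rw [h5 i hi, ← Sym2.map_mk]
  exact (Sym2.map.injective f.injective).eq_iff.symm

end Glue

section Far

variable {m a n₀ N₀ n n' d : ℕ} {G H : SimpleGraph ℕ} {Y : Finset ℕ}

theorem exists_walk_off {V : Type*} {H : SimpleGraph V} {S : Set V} {z : V} (C : H.Walk z z)
    (hC : C.IsCycle) (hS : ∀ v ∈ C.support, v ∉ S) :
    ∃ C' : (off H S).Walk z z, C'.IsCycle ∧ C'.length = C.length ∧ C'.support = C.support := by
  have he : ∀ e ∈ C.edges, e ∈ (off H S).edgeSet := by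
    intro e
    induction e with
    | _ u v =>
      exact fun h => ⟨C.adj_of_mem_edges h, hS _ (C.fst_mem_support_of_mem_edges h),
        hS _ (C.snd_mem_support_of_mem_edges h)⟩
  exact ⟨C.transfer _ he, hC.transfer he, Walk.length_transfer _ he, Walk.support_transfer _ he⟩

/-- Among `m` cycles of the same length, one is far from fewer than `m` given vertices. -/
theorem Good.exists_far_cycle (hH : Good m a n₀ N₀ n H) {b : ℕ} (hb : 3 ≤ b) (hba : b ≤ a)
    (hd : 2 * d < a) (hY : Y.card < m) (hda : Y = ∅ ∨ 4 * d < a) :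
    ∃ (z : ℕ) (C : (off H (seg n₀)).Walk z z), C.IsCycle ∧ C.length = b ∧
      ∀ v ∈ C.support, ∀ s ∈ (Y : Set ℕ) ∪ seg n₀, ∀ w : H.Walk v s, 2 * d < w.length := by
  obtain ⟨f, hf, hne⟩ := hH.q2 b hb hba
  have hseg : ∀ i, ∀ v ∈ (f i).2.support, ∀ s ∈ seg n₀, ∀ w : H.Walk v s, 2 * d < w.length := by
    intro i v hv s hs w
    rcases hH.q1.1 _ (f i).2 (hf i).1 ((hf i).2.1.trans_le hba) with h | h
    · exact absurd (h.1 v hv) ((hf i).2.2 v hv)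
    · have := h s hs v hv w.reverse
      rw [Walk.length_reverse] at this
      omega
  have hoff : ∀ i, ∀ v ∈ (f i).2.support, v ∉ seg n₀ := fun i v hv hs => by
    have := hseg i v hv v hs .nil
    simp at this
  obtain ⟨i, hi⟩ : ∃ i, ∀ v ∈ (f i).2.support, ∀ s ∈ Y, ∀ w : H.Walk v s, 2 * d < w.length := by
    by_contra! hcon
    choose v hv s hs w hw using hcon
    obtain ⟨i, -, j, -, hij, heq⟩ := Finset.exists_ne_map_eq_of_card_lt_of_maps_to
      (s := Finset.univ) (t := Y) (by simpa using hY) (f := s) fun i _ => hs i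
    have h4 : 4 * d < a := hda.resolve_left (Finset.ne_empty_of_mem (hs i))
    have := hH.q1.2.2 _ _ (f i).2 (f j).2 (hf i).1 (hf j).1 ((hf i).2.1.trans_le hba)
      ((hf j).2.1.trans_le hba) (hoff i) (hoff j) (hne i j hij) _ (hv i) _ (hv j)
      ((w i).append ((w j).reverse.copy heq.symm rfl))
    have h1 := hw i
    have h2 := hw j
    simp at this
    omega
  obtain ⟨C, h1, h2, h3⟩ := exists_walk_off (f i).2 (hf i).1 (hoff i)
  refine ⟨_, C, h1, h2.trans (hf i).2.1, fun v hv s hs w => ?_⟩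
  rw [h3] at hv
  exact hs.elim (fun hs => hi v hv s hs w) fun hs => hseg i v hv s hs w

theorem Sparse.length_eq {V : Type*} {G : SimpleGraph V} (hG : Sparse G a) {x y : V}
    (c : G.Walk x x) (c' : G.Walk y y) (hc : c.IsCycle) (hc' : c'.IsCycle) (h : c.length ≤ a)
    (h' : c'.length ≤ a) (p : G.Walk x y) (hp : p.length < a) : c.length = c'.length := by
  rw [← Walk.length_edges, ← Walk.length_edges]
  exact ((List.perm_ext_iff_of_nodup hc.edges_nodup hc'.edges_nodup).2
    (hG x y c c' hc hc' h h' x (by simp) y (by simp) p hp)).length_eq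

theorem not_near_of_far {z y : ℕ} {S : Set ℕ} (hz : ∀ s ∈ S, ∀ w : H.Walk z s, 2 * d < w.length)
    (w : H.Walk z y) (hw : w.length ≤ d) : ¬Near H S y d := fun h => by
  obtain ⟨s, hs, w', hw'⟩ := h.exists_walk
  have := hz s hs (w.append w')
  rw [Walk.length_append] at this
  omega

theorem Sparse.hull_eq {V : Type*} {G : SimpleGraph V} (hG : Sparse G a) {z : V} (c : G.Walk z z)
    (hc : c.IsCycle) {L : ℕ} (hL : L + c.length ≤ a) (hcL : c.length ≤ L) :
    hull G {z} L = edgeGraph c :=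
  le_antisymm ((hull_mono le_rfl (by simp [verts]) le_rfl).trans (hG.confined c hc hL).hull_le)
    fun _ _ h => hull_mono le_rfl subset_rfl hcL (cycle_le_hull c hc h)

theorem hull_far_base_eq_bot (hH : Good m a n₀ N₀ n H) {z : ℕ} (C : (off H (seg n₀)).Walk z z)
    (hC : C.IsCycle) (hl : C.length = a) (hda : d < a)
    (hz : ∀ s ∈ seg n₀, ∀ w : H.Walk z s, 2 * d < w.length) : hull H {z} d = ⊥ := by
  refine hull_eq_bot fun r k h => ?_
  by_contra! hk
  have hfar := not_near_of_far hz .nil (by simp)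
  rcases h.avoid (S := seg n₀) (T' := into {z}) (fun _ _ h _ => h) (fun h => hfar (.inl h)) with
    ⟨c, hc, h⟩ | h
  · exact hfar (.inr ⟨r, c, by omega, h⟩)
  · obtain ⟨y, τ, c, hc, hl'⟩ := h.exists_cycle
    have := hH.sparse.length_eq C c hC hc hl.le (by omega) τ (by omega)
    omega

/-- A vertex far from `[n₀]` has a counterpart far from a few given vertices. -/
theorem exists_far_answer (hG : Good m a n₀ N₀ n G) (hH : Good m a n₀ N₀ n' H) {x : ℕ}
    (hx : ¬Near G (seg n₀) x d) (hd : 2 * d < a) (hd3 : 3 ≤ d → 4 * d ≤ a) (hY : Y.card < m)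
    (hda : Y = ∅ ∨ 4 * d < a) :
    ∃ g : ℕ ≃ ℕ, g x ∈ Finset.Icc 1 n' ∧ Carries g (hull G {x} d) (hull H {g x} d) ∧
      ¬Near H (Y ∪ seg n₀) (g x) d := by
  classical
  by_cases hbot : ∀ r k, NB G (into {x}) x r k → d < k
  · obtain ⟨z, C, hC, hl, hfar⟩ := hH.exists_far_cycle hG.three_le_a le_rfl hd hY hda
    have hz := hfar z (by simp)
    refine ⟨Equiv.swap x z, ?_, ?_, ?_⟩ <;> rw [Equiv.swap_apply_left]
    · exact (hH.vert _ _ (C.adj_snd hC.not_nil).1).1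
    · rw [hull_eq_bot hbot, hull_far_base_eq_bot hH C hC hl (by omega) fun s hs => hz s (.inr hs)]
      exact fun _ _ => Iff.rfl
    · exact not_near_of_far hz .nil (by simp)
  · push Not at hbot
    obtain ⟨r, k, h, hk⟩ := hbot
    obtain ⟨p, τ, c, hc, hτ⟩ := ((h.avoid (S := seg n₀) (T' := into {x}) (fun _ _ h _ => h)
      (fun h => hx (.inl h))).resolve_left
        fun ⟨c, hc, h⟩ => hx (.inr ⟨r, c, by omega, h⟩)).exists_cycle
    have h3 := hc.three_le_length
    have h4 := hd3 (by omega)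
    obtain ⟨z, C, hC, hl, hfar⟩ := hH.exists_far_cycle h3 (by omega) hd hY hda
    have hz := hfar z (by simp)
    have hzn : z ∈ Finset.Icc 1 n' := (hH.vert _ _ (C.adj_snd hC.not_nil).1).1
    obtain ⟨f, rfl, hf⟩ := exists_cycle_iso c C hc hC hl.symm
    rw [← hG.sparse.hull_eq (L := 3 * d) c hc (by omega) (by omega),
      ← hH.sparse.hull_eq (L := 3 * d) C hC (by omega) (by omega), ← Set.image_singleton] at hf
    have hnbr : ∀ y, Near (off H (seg n₀)) {f p} y (d - 1) → ∀ w, H.Adj y w →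
        (off H (seg n₀)).Adj y w := by
      intro y hy w hyw
      obtain ⟨_, rfl, q, hq⟩ := hy.exists_walk
      refine ⟨hyw, fun hs => ?_, fun hs => ?_⟩
      · have := hz _ (.inr hs) (q.mapLe (off_le _)).reverse
        simp at this
        omega
      · have := hz _ (.inr hs) ((q.mapLe (off_le _)).reverse.concat hyw)
        simp at this
        omega
    obtain ⟨g, hgp, hgx, hg⟩ := exists_near_answer hf (d' := d) (by omega) (fun _ => le_rfl) (by
      intro y hy
      rw [Set.image_singleton] at hy
      have hyn : y ∈ Finset.Icc 1 n' := by
        rcases hy with rfl | ⟨r, i, hi, h⟩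
        · exact hzn
        · exact (hH.vert _ _ (off_le _ h.adj)).1
      have hy' : Near (off H (seg n₀)) {f p} y (d - 1) :=
        hy.imp_right fun ⟨r, i, hi, h⟩ => ⟨r, i, by omega, h⟩
      obtain ⟨W, hWc, hW⟩ := hH.exists_outer hyn
      have hm := hH.three_le_m
      constructor
      · have h2 := card_filter_edgeGraph_le (z := y) C hC W
        obtain ⟨w, hw, hw'⟩ := Finset.exists_mem_notMem_of_card_lt_card
          (h2.trans_lt (by omega : 2 < W.card))
        refine ⟨w, hnbr y hy' w (hW w hw).1, fun h => hw' ?_⟩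
        rw [Set.image_singleton, hH.sparse.hull_eq C hC (by omega) (by omega)] at h
        exact Finset.mem_filter.2 ⟨hw, h⟩
      · intro u
        obtain ⟨w, hw, hwu⟩ := Finset.exists_mem_ne (by omega : 1 < W.card) u
        exact ⟨w, hwu, hnbr y hy' w (hW w hw).1⟩)
      (nb_of_walk τ (Set.mem_singleton p) |>.imp_right fun ⟨r, k, hk, h⟩ => ⟨r, k, by omega, h⟩)
    rw [Set.image_singleton] at hgx
    obtain ⟨_, rfl, q, hq⟩ := hgx.exists_walk
    have hfar' : ¬Near H (Y ∪ seg n₀) (g x) d :=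
      not_near_of_far hz (q.mapLe (off_le _)).reverse (by simpa using hq)
    refine ⟨g, ?_, ?_, hfar'⟩
    · rcases hgx with h | ⟨r, k, hk, h⟩
      · rw [Set.mem_singleton_iff.1 h]
        exact hzn
      · exact (hH.vert _ _ (off_le _ h.adj)).1
    · rw [← hull_off hx, ← hull_off fun h => hfar' (h.mono Set.subset_union_right le_rfl),
        ← Set.image_singleton]
      refine hg.hull (hull_le _ _) (hull_le _ _) (hull_mono le_rfl Set.subset_union_right le_rfl)
        (hull_mono le_rfl (Set.image_mono Set.subset_union_right) le_rfl)

end Far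

section Game

variable {m a n₀ N₀ n n' d d' : ℕ} {G H : SimpleGraph ℕ} {D : Finset ℕ} {f : ℕ ≃ ℕ} {v w : ℕ → ℕ}

/-- Duplicator's invariant: `f` is an isomorphism between the `d`-hulls of the pebbles together
with `[n₀]`. -/
structure Matching (n₀ n n' : ℕ) (G H : SimpleGraph ℕ) (D : Finset ℕ) (f : ℕ ≃ ℕ) (v w : ℕ → ℕ)
    (d : ℕ) : Prop where
  agree : ∀ i ∈ D, f (v i) = w i
  fix : ∀ s ∈ seg n₀, f s = s
  left : ∀ i ∈ D, v i ∈ Finset.Icc 1 n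
  right : ∀ i ∈ D, w i ∈ Finset.Icc 1 n'
  carries : Carries f (hull G (D.image v ∪ seg n₀) d) (hull H (D.image w ∪ seg n₀) d)

theorem image_pebbles (hD : ∀ i ∈ D, f (v i) = w i) (hs : ∀ s ∈ seg n₀, f s = s) :
    f '' (D.image v ∪ seg n₀) = (D.image w : Set ℕ) ∪ seg n₀ := by
  rw [Set.image_union, Set.image_congr hs, Set.image_id', Finset.coe_image, Finset.coe_image,
    Set.image_image, Set.image_congr hD]

theorem Matching.symm (h : Matching n₀ n n' G H D f v w d) :
    Matching n₀ n' n H G D f.symm w v d where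
  agree i hi := by rw [← h.agree i hi, Equiv.symm_apply_apply]
  fix s hs := by rw [Equiv.symm_apply_eq, h.fix s hs]
  left := h.right
  right := h.left
  carries := h.carries.symm

theorem Matching.mono (h : Matching n₀ n n' G H D f v w d) {D' : Finset ℕ} (hD : D' ⊆ D) :
    Matching n₀ n n' G H D' f v w d where
  agree i hi := h.agree i (hD hi)
  fix := h.fix
  left i hi := h.left i (hD hi)
  right i hi := h.right i (hD hi)
  carries := by
    have hsub : ∀ u : ℕ → ℕ, (D'.image u : Set ℕ) ∪ seg n₀ ⊆ D.image u ∪ seg n₀ := fun u =>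
      Set.union_subset_union_left _ (Finset.coe_subset.2 (Finset.image_subset_image hD))
    rw [← image_pebbles (fun i hi => h.agree i (hD hi)) h.fix]
    refine h.carries.hull (hull_le _ _) (hull_le _ _) (hull_mono le_rfl (hsub v) le_rfl) ?_
    rw [image_pebbles (fun i hi => h.agree i (hD hi)) h.fix]
    exact hull_mono le_rfl (hsub w) le_rfl

theorem Good.seg_subset (hG : Good m a n₀ N₀ n G) {s : ℕ} (hs : s ∈ seg n₀) :
    s ∈ Finset.Icc 1 n := by
  have hs' : s ∈ Finset.Icc 1 N₀ := Finset.Icc_subset_Icc_right hG.le hs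
  have := hG.q3 s hs'
  have := hG.three_le_m
  obtain ⟨t, ht⟩ := Set.nonempty_of_ncard_ne_zero (s := {t | G.Adj s t}) (by
    change ndeg G s ≠ 0
    omega)
  exact (hG.vert _ _ ht).1

/-- Duplicator can answer, preserving the invariant at the next scale. -/
theorem Matching.exists_answer (hG : Good m a n₀ N₀ n G) (hH : Good m a n₀ N₀ n' H)
    (h : Matching n₀ n n' G H D f v w d) (hD : D.card + 3 ≤ m) (hd : 2 * d' ≤ d)
    (hd2 : 2 ≤ d' → 3 * d' ≤ d) (hd3 : 3 ≤ d' → 4 * d' ≤ a) (hda : d < a)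
    (hda4 : D = ∅ ∨ 4 * d < a) {i : ℕ} (hi : i ∉ D) {x : ℕ} (hx : x ∈ Finset.Icc 1 n) :
    ∃ y ∈ Finset.Icc 1 n', ∃ g, Matching n₀ n n' G H (insert i D) g (Function.update v i x)
      (Function.update w i y) d' := by
  classical
  set S : Set ℕ := D.image v ∪ seg n₀ with hS
  have hfS : f '' S = (D.image w : Set ℕ) ∪ seg n₀ := image_pebbles h.agree h.fix
  have hf : Carries f (hull G S d) (hull H (f '' S) d) := hfS ▸ h.carries
  have hSn : S ⊆ Finset.Icc 1 n := by
    rintro s (hs | hs)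
    · obtain ⟨j, hj, rfl⟩ := Finset.mem_image.1 (Finset.mem_coe.1 hs)
      exact h.left j hj
    · exact hG.seg_subset hs
  have hfSn : f '' S ⊆ Finset.Icc 1 n' := by
    rw [hfS]
    rintro s (hs | hs)
    · obtain ⟨j, hj, rfl⟩ := Finset.mem_image.1 (Finset.mem_coe.1 hs)
      exact h.right j hj
    · exact hH.seg_subset hs
  have hempty : D.image w = ∅ ∨ 4 * d < a := by rwa [Finset.image_eq_empty]
  have hcard : (D.image w).card + 3 ≤ m := (Nat.add_le_add_right Finset.card_image_le 3).trans hD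
  suffices hg : ∃ g : ℕ ≃ ℕ, (∀ s ∈ S, g s = f s) ∧ g x ∈ Finset.Icc 1 n' ∧
      Carries g (hull G (S ∪ {x}) d') (hull H (g '' (S ∪ {x})) d') by
    obtain ⟨g, hgS, hgx, hg⟩ := hg
    have hupd : ∀ {u : ℕ → ℕ} {j z}, j ∈ D → Function.update u i z j = u j := fun {u j z} hj =>
      Function.update_of_ne (by rintro rfl; exact hi hj) _ _
    have hagree : ∀ j ∈ insert i D, g (Function.update v i x j) = Function.update w i (g x) j := by
      intro j hj
      rcases Finset.mem_insert.1 hj with rfl | hj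
      · simp
      · rw [hupd hj, hupd hj, ← h.agree j hj]
        exact hgS _ (.inl (Finset.mem_coe.2 (Finset.mem_image_of_mem v hj)))
    have hfix : ∀ s ∈ seg n₀, g s = s := fun s hs => (hgS s (.inr hs)).trans (h.fix s hs)
    refine ⟨g x, hgx, g, hagree, hfix, fun j hj => ?_, fun j hj => ?_, ?_⟩
    · rcases Finset.mem_insert.1 hj with rfl | hj
      · simpa using hx
      · rw [hupd hj]
        exact h.left j hj
    · rcases Finset.mem_insert.1 hj with rfl | hj
      · simpa using hgx
      · rw [hupd hj]
        exact h.right j hj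
    · have himg : ((insert i D).image (Function.update v i x) : Set ℕ) ∪ seg n₀ = S ∪ {x} := by
        rw [Finset.image_insert, Function.update_self,
          Finset.image_congr (g := v) (fun j hj => hupd hj), Finset.coe_insert, hS,
          Set.insert_union, Set.union_singleton]
      rw [← image_pebbles hagree hfix, himg]
      exact hg
  by_cases hnear : Near G S x d'
  · obtain ⟨g, hgS, hgx, hg⟩ := exists_near_answer hf hd hd2 (by
      intro z hz
      have hzn : z ∈ Finset.Icc 1 n' := by
        rcases hz with hz | ⟨r, i, -, hz⟩
        · exact hfSn hz
        · exact (hH.vert _ _ hz.adj).1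
      refine ⟨hfS ▸ hH.exists_fresh hcard hzn hda hempty, fun u => ?_⟩
      obtain ⟨W, hWc, hW⟩ := hH.exists_outer hzn
      obtain ⟨t, ht, htu⟩ := Finset.exists_mem_ne (by omega : 1 < W.card) u
      exact ⟨t, htu, (hW t ht).1⟩) hnear
    refine ⟨g, hgS, ?_, hg⟩
    rcases hgx with hgx | ⟨r, k, -, hgx⟩
    · exact hfSn hgx
    · exact (hH.vert _ _ hgx.adj).1
  · obtain ⟨g, hgx, hg, hfar⟩ := exists_far_answer hG hH
      (fun h => hnear (h.mono Set.subset_union_right le_rfl)) (by omega) hd3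
      (by omega : (D.image w).card < m) (hempty.imp_right (by omega))
    rw [← hfS] at hfar
    obtain ⟨e, heS, hex, he⟩ := exists_glue (Finset.finite_toSet (Finset.Icc 1 n))
      (fun u r h => (hG.vert u r h).1) hSn hx (hf.hull (S := S) (d := d') (hull_le _ _)
        (hull_le _ _) (hull_mono le_rfl subset_rfl (by omega))
        (hull_mono le_rfl subset_rfl (by omega))) hg hnear hfar
    exact ⟨e, heS, hex ▸ hgx, he⟩

theorem Matching.adj_iff (h : Matching n₀ n n' G H D f v w d) (hd : 1 ≤ d) {i j : ℕ} (hi : i ∈ D)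
    (hj : j ∈ D) : G.Adj (v i) (v j) ↔ H.Adj (w i) (w j) := by
  have key : ∀ {G : SimpleGraph ℕ} {v : ℕ → ℕ}, G.Adj (v i) (v j) →
      (hull G (D.image v ∪ seg n₀) d).Adj (v i) (v j) := fun {G v} hadj =>
    ⟨1, 1, .base hadj (.inl (Finset.mem_coe.2 (Finset.mem_image_of_mem v hj))),
      .base hadj.symm (.inl (Finset.mem_coe.2 (Finset.mem_image_of_mem v hi))), by omega⟩
  have := h.carries (v i) (v j)
  rw [h.agree i hi, h.agree j hj] at this
  exact ⟨fun h => hull_le _ _ (this.1 (key h)), fun h => hull_le _ _ (this.2 (key h))⟩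

/-- The radius of the hulls that are matched with `r` rounds to go. -/
def scale : ℕ → ℕ
  | 0 => 1
  | r + 1 => 2 * 3 ^ r

theorem one_le_scale (r : ℕ) : 1 ≤ scale r := by
  cases r with
  | zero => exact le_rfl
  | succ r => exact Nat.mul_pos two_pos (pow_pos (by norm_num) r)

theorem two_mul_scale_le (r : ℕ) : 2 * scale r ≤ scale (r + 1) := by
  cases r with
  | zero => exact le_rfl
  | succ r => simp only [scale, pow_succ]; omega

theorem three_mul_scale_le {r : ℕ} (h : 2 ≤ scale r) : 3 * scale r ≤ scale (r + 1) := by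
  cases r with
  | zero => simp [scale] at h
  | succ r => simp only [scale, pow_succ]; omega

theorem four_mul_scale_lt {r : ℕ} (h : 2 ≤ scale r) : 4 * scale r < 3 ^ (r + 1) := by
  cases r with
  | zero => simp [scale] at h
  | succ r =>
    have := pow_pos (by norm_num : 0 < 3) r
    simp only [scale, pow_succ]
    omega

theorem scale_lt {r : ℕ} (h : 1 ≤ r) : scale r < 3 ^ r := by
  obtain ⟨r, rfl⟩ := Nat.exists_eq_add_of_le' h
  have := pow_pos (by norm_num : 0 < 3) r
  simp only [scale, pow_succ]
  omega

theorem Matching.exists_next {r R : ℕ} (hG : Good m (3 ^ R) n₀ N₀ n G)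
    (hH : Good m (3 ^ R) n₀ N₀ n' H) (h : Matching n₀ n n' G H D f v w (scale (r + 1)))
    (hr : r + 1 ≤ R) (hD : D = ∅ ∨ r + 1 < R) {X : Finset ℕ} (hDX : D ⊆ X) (hX : X.card + 2 ≤ m)
    {i : ℕ} (hi : i ∈ X) {x : ℕ} (hx : x ∈ Finset.Icc 1 n) :
    ∃ y ∈ Finset.Icc 1 n', ∃ g, Matching n₀ n n' G H (insert i D) g (Function.update v i x)
      (Function.update w i y) (scale r) := by
  have hpow : ∀ {k}, k ≤ R → 3 ^ k ≤ 3 ^ R := fun hk => Nat.pow_le_pow_right (by norm_num) hk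
  have hscale := two_mul_scale_le r
  have hone := one_le_scale r
  rw [show insert i D = insert i (D.erase i) by ext j; by_cases j = i <;> simp [*]]
  have hcard : (D.erase i).card + 3 ≤ m := by
    have := Finset.card_le_card (Finset.erase_subset_erase i hDX)
    have := Finset.card_erase_add_one hi
    omega
  exact (h.mono (Finset.erase_subset i D)).exists_answer hG hH hcard hscale three_mul_scale_le
    (fun h => (four_mul_scale_lt (by omega)).le.trans (hpow hr))
    ((scale_lt (by omega)).trans_le (hpow hr))
    (hD.imp (fun h => by simp [h]) fun h => (four_mul_scale_lt (by omega)).trans_le (hpow h))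
    (Finset.notMem_erase i D) hx

theorem Matching.eval_iff {R : ℕ} (hG : Good m (3 ^ R) n₀ N₀ n G)
    (hH : Good m (3 ^ R) n₀ N₀ n' H) {X : Finset ℕ} (hX : X.card + 2 ≤ m) (φ : FOFormula)
    {r : ℕ} (h : Matching n₀ n n' G H D f v w (scale r)) (hr : r ≤ R) (hD : D = ∅ ∨ r < R)
    (hDX : D ⊆ X) (hφ : φ.freeVars ⊆ D) (hφX : φ.vars ⊆ X) (hq : φ.qdepth ≤ r) :
    φ.Eval G (Finset.Icc 1 n) v ↔ φ.Eval H (Finset.Icc 1 n') w := by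
  induction φ generalizing r D f v w with
  | eq i j =>
    simp only [FOFormula.freeVars, Finset.insert_subset_iff, Finset.singleton_subset_iff] at hφ
    simp only [FOFormula.Eval]
    rw [← h.agree i hφ.1, ← h.agree j hφ.2, f.injective.eq_iff]
  | adj i j =>
    simp only [FOFormula.freeVars, Finset.insert_subset_iff, Finset.singleton_subset_iff] at hφ
    exact h.adj_iff (one_le_scale r) hφ.1 hφ.2
  | not φ ih => exact not_congr (ih h hr hD hDX hφ hφX hq)
  | and φ ψ ih ih' =>
    simp only [FOFormula.freeVars, FOFormula.vars, Finset.union_subset_iff] at hφ hφX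
    obtain ⟨hq, hq'⟩ := max_le_iff.1 hq
    exact and_congr (ih h hr hD hDX hφ.1 hφX.1 hq) (ih' h hr hD hDX hφ.2 hφX.2 hq')
  | or φ ψ ih ih' =>
    simp only [FOFormula.freeVars, FOFormula.vars, Finset.union_subset_iff] at hφ hφX
    obtain ⟨hq, hq'⟩ := max_le_iff.1 hq
    exact or_congr (ih h hr hD hDX hφ.1 hφX.1 hq) (ih' h hr hD hDX hφ.2 hφX.2 hq')
  | ex i φ ih =>
    simp only [FOFormula.freeVars, FOFormula.vars, FOFormula.qdepth,
      Finset.insert_subset_iff] at hφ hφX hq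
    obtain ⟨r, rfl⟩ := Nat.exists_eq_add_of_le' (Nat.one_le_of_lt hq)
    have ih' := fun {f v w} (h : Matching n₀ n n' G H (insert i D) f v w (scale r)) =>
      ih h (by omega) (.inr (by omega)) (Finset.insert_subset hφX.1 hDX)
        (Finset.subset_insert_iff.2 hφ) hφX.2 (by omega)
    constructor
    · rintro ⟨x, hx, hev⟩
      obtain ⟨y, hy, g, hg⟩ := h.exists_next hG hH hr hD hDX hX hφX.1 hx
      exact ⟨y, hy, (ih' hg).1 hev⟩
    · rintro ⟨y, hy, hev⟩
      obtain ⟨x, hx, g, hg⟩ := h.symm.exists_next hH hG hr hD hDX hX hφX.1 hy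
      exact ⟨x, hx, (ih' hg.symm).2 hev⟩
  | all i φ ih =>
    simp only [FOFormula.freeVars, FOFormula.vars, FOFormula.qdepth,
      Finset.insert_subset_iff] at hφ hφX hq
    obtain ⟨r, rfl⟩ := Nat.exists_eq_add_of_le' (Nat.one_le_of_lt hq)
    have ih' := fun {f v w} (h : Matching n₀ n n' G H (insert i D) f v w (scale r)) =>
      ih h (by omega) (.inr (by omega)) (Finset.insert_subset hφX.1 hDX)
        (Finset.subset_insert_iff.2 hφ) hφX.2 (by omega)
    constructor
    · intro hev y hy
      obtain ⟨x, hx, g, hg⟩ := h.symm.exists_next hH hG hr hD hDX hX hφX.1 hy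
      exact (ih' hg.symm).1 (hev x hx)
    · intro hev x hx
      obtain ⟨y, hy, g, hg⟩ := h.exists_next hG hH hr hD hDX hX hφX.1 hx
      exact (ih' hg).2 (hev y hy)

theorem hull_seg_le (hG : Good m a n₀ N₀ n G) (hsame : inner G N₀ = inner H N₀) (hd : d < a) :
    hull G (seg n₀) d ≤ hull H (seg n₀) d := by
  have hle : hull G (seg n₀) d ≤ H :=
    (hG.confined.anti (by omega)).hull_le.trans (hsame ▸ fun _ _ h => h.1)
  rintro u v ⟨a, b, ha, hb, hab⟩
  exact ⟨a, b, (ha.in_hull hb hab).mono hle fun _ _ => id,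
    (hb.in_hull ha (by omega)).mono hle fun _ _ => id, hab⟩

theorem Good.nonempty (hG : Good m a n₀ N₀ n G) : (Finset.Icc 1 n).Nonempty := by
  have hm := hG.three_le_m
  obtain ⟨c, hc, -⟩ := hG.q2 3 le_rfl hG.three_le_a
  exact ⟨_, (hG.vert _ _ ((c ⟨0, by omega⟩).2.adj_snd (hc _).1.not_nil)).1⟩

/-- The invariant holds before the first move. -/
theorem matching_empty (hG : Good m a n₀ N₀ n G) (hH : Good m a n₀ N₀ n' H)
    (hsame : inner G N₀ = inner H N₀) (hd : d < a) :
    Matching n₀ n n' G H ∅ (Equiv.refl ℕ) v w d where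
  agree := by simp
  fix := by simp
  left := by simp
  right := by simp
  carries := by
    have : hull G (seg n₀) d = hull H (seg n₀) d :=
      (hull_seg_le hG hsame hd).antisymm (hull_seg_le hH hsame.symm hd)
    simp [this, Carries]

theorem Good.sat_of_sat {R : ℕ} (hG : Good m (3 ^ R) n₀ N₀ n G) (hH : Good m (3 ^ R) n₀ N₀ n' H)
    (hsame : inner G N₀ = inner H N₀) {φ : FOFormula} (hφ : φ.freeVars = ∅)
    (hvars : φ.vars.card + 2 ≤ m) (hq : φ.qdepth ≤ R) (h : φ.Sat G (Finset.Icc 1 n)) :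
    φ.Sat H (Finset.Icc 1 n') := by
  intro w _
  obtain ⟨x, hx⟩ := hG.nonempty
  have hR : 1 ≤ R := by
    by_contra! hR
    have := hG.three_le_a
    rw [Nat.lt_one_iff.1 hR] at this
    omega
  have hmatch : Matching n₀ n n' G H ∅ (Equiv.refl ℕ) (fun _ => x) w (scale R) :=
    matching_empty hG hH hsame (scale_lt hR)
  exact (hmatch.eval_iff hG hH hvars φ le_rfl (.inl rfl) (Finset.empty_subset _) hφ.subset
    subset_rfl hq).1 (h _ fun _ => hx)

end Game

end HullGame

/-- Fix `m ≥ 3`, `R ≥ m − 2`, `a = 3^R` and `n₀ ≤ N₀`. If `H₁`, `H₂` are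
graphs on the vertex sets `[n₁]`, `[n₂]` with minimum degree at least `m` that coincide on
`[N₀]` and both satisfy `Q1`, `Q2` and `Q3` (every vertex of `[N₀]` has degree at least
`N₀ + m`), then `H₁` and `H₂` satisfy exactly the same first-order sentences using at most
`m − 2` distinct variables and having quantifier depth at most `R`. -/
theorem duplicator_wins_agreement
    (m R a n₀ N₀ n₁ n₂ : ℕ) (hm : 3 ≤ m) (hR : m - 2 ≤ R) (ha : a = 3 ^ R)
    (hn₀N₀ : n₀ ≤ N₀)
    (H₁ H₂ : SimpleGraph ℕ)
    (hV₁ : ∀ u v : ℕ, H₁.Adj u v → u ∈ Finset.Icc 1 n₁ ∧ v ∈ Finset.Icc 1 n₁)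
    (hV₂ : ∀ u v : ℕ, H₂.Adj u v → u ∈ Finset.Icc 1 n₂ ∧ v ∈ Finset.Icc 1 n₂)
    (hdeg₁ : ∀ v ∈ Finset.Icc 1 n₁, m ≤ ndeg H₁ v)
    (hdeg₂ : ∀ v ∈ Finset.Icc 1 n₂, m ≤ ndeg H₂ v)
    (hsame : ∀ u v : ℕ, u ∈ Finset.Icc 1 N₀ → v ∈ Finset.Icc 1 N₀ →
      (H₁.Adj u v ↔ H₂.Adj u v))
    (hQ1₁ : PropQ1 H₁ a n₀ N₀) (hQ1₂ : PropQ1 H₂ a n₀ N₀)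
    (hQ2₁ : PropQ2 H₁ a m N₀) (hQ2₂ : PropQ2 H₂ a m N₀)
    (hQ3₁ : ∀ v ∈ Finset.Icc 1 N₀, N₀ + m ≤ ndeg H₁ v)
    (hQ3₂ : ∀ v ∈ Finset.Icc 1 N₀, N₀ + m ≤ ndeg H₂ v)
    (φ : FOFormula) (hsentence : φ.freeVars = ∅)
    (hvars : φ.vars.card ≤ m - 2) (hdepth : φ.qdepth ≤ R) :
    (FOFormula.Sat H₁ (Finset.Icc 1 n₁) φ ↔ FOFormula.Sat H₂ (Finset.Icc 1 n₂) φ) := by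
  subst ha
  have h3 : 3 ≤ 3 ^ R := by
    simpa using Nat.pow_le_pow_right (by norm_num : 0 < 3) (by omega : 1 ≤ R)
  have hG : HullGame.Good m (3 ^ R) n₀ N₀ n₁ H₁ :=
    ⟨hm, h3, hn₀N₀, hV₁, hdeg₁, hQ1₁, hQ2₁, hQ3₁⟩
  have hH : HullGame.Good m (3 ^ R) n₀ N₀ n₂ H₂ :=
    ⟨hm, h3, hn₀N₀, hV₂, hdeg₂, hQ1₂, hQ2₂, hQ3₂⟩
  have hinner : HullGame.inner H₁ N₀ = HullGame.inner H₂ N₀ := by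
    ext u v
    exact and_congr_left fun h => hsame u v h.1 h.2
  exact ⟨hG.sat_of_sat hH hinner hsentence (by omega) hdepth,
    hH.sat_of_sat hG hinner.symm hsentence (by omega) hdepth⟩
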